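/- arXiv:0903.1746 — 2 statements merged into one kernel-verified Lean document; each statement's English description precedes it below -/
import Mathlib

section
/- There exists a ring R with the following properties: (i) R is von Neumann regular; (ii) R is right semiartinian of Loewy length exactly 2, i.e. Soc(R_R) ≠ R and R/Soc(R_R) is a semisimple ring; (iii) for every simple right R-module U, the quotient ring R/ann(U) is right artinian; and (iv) R does not satisfy the general comparability axiom, i.e. there exist x, y ∈ R such that for every central idempotent e ∈ R it is not the case that both e·xR ≲ e·yR and (1−e)·yR ≲ (1−e)·xR. -/
open MulOpposite

/-- A ring is right semiartinian if every nonzero right module contains a simple submodule. -/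
def RightSemiartinian (R : Type) [Ring R] : Prop :=
  ∀ (M : Type) [AddCommGroup M] [Module Rᵐᵒᵖ M], Nontrivial M →
    ∃ N : Submodule Rᵐᵒᵖ M, IsSimpleModule Rᵐᵒᵖ ↥N

/-- The right socle of a ring `R`: the sum of all simple right ideals of `R`. -/
def rightSocle (R : Type) [Ring R] : Ideal Rᵐᵒᵖ :=
  sSup {I : Ideal Rᵐᵒᵖ | IsAtom I}

/-- `A ≲ B` for right ideals: there is an injective `Rᵐᵒᵖ`-linear map `A →ₗ B`. -/
def RightIdealSubiso (R : Type) [Ring R] (A B : Ideal Rᵐᵒᵖ) : Prop :=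
  ∃ f : ↥A →ₗ[Rᵐᵒᵖ] ↥B, Function.Injective f

/-- The ring of sequences of `2 × 2` matrices over `𝔽₂` that are eventually equal to a fixed
diagonal matrix; the diagonal limit is recorded in the first component. -/
def eventuallyDiagonal :
    Subring ((Fin 2 → ZMod 2) × (ℕ → Matrix (Fin 2) (Fin 2) (ZMod 2))) where
  carrier := {a | ∃ N, ∀ n ≥ N, a.2 n = Matrix.diagonal a.1}
  mul_mem' := by
    rintro a b ⟨N, hN⟩ ⟨N', hN'⟩
    refine ⟨max N N', fun n hn => ?_⟩
    simp only [ge_iff_le, sup_le_iff] at hn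
    simp [hN n hn.1, hN' n hn.2, Pi.mul_def]
  one_mem' := ⟨0, fun n _ => by simp [← Matrix.diagonal_one]⟩
  add_mem' := by
    rintro a b ⟨N, hN⟩ ⟨N', hN'⟩
    refine ⟨max N N', fun n hn => ?_⟩
    simp only [ge_iff_le, sup_le_iff] at hn
    simp [hN n hn.1, hN' n hn.2, Pi.add_def]
  zero_mem' := ⟨0, fun n _ => by simp⟩
  neg_mem' := by
    rintro a ⟨N, hN⟩
    exact ⟨N, fun n hn => by simp [hN n hn, Pi.neg_def]⟩

namespace eventuallyDiagonal

/-- The sequence with value `m` at `n` and zero elsewhere. -/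
def bump (n : ℕ) (m : Matrix (Fin 2) (Fin 2) (ZMod 2)) : eventuallyDiagonal :=
  ⟨(0, Pi.single n m), n + 1, fun k hk => by
    have : k ≠ n := by omega
    simp [this]⟩

/-- The constant sequence with value `diagonal d`. -/
def const (d : Fin 2 → ZMod 2) : eventuallyDiagonal :=
  ⟨(d, fun _ => Matrix.diagonal d), 0, fun _ _ => rfl⟩

lemma mul_bump (a : eventuallyDiagonal) (n : ℕ) (m : Matrix (Fin 2) (Fin 2) (ZMod 2)) :
    a * bump n m = bump n (a.1.2 n * m) := by
  apply Subtype.ext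
  refine Prod.ext (by simp [bump]) (funext fun k => ?_)
  by_cases h : k = n
  · subst h; simp [bump]
  · simp [bump, h]

lemma bump_mul (a : eventuallyDiagonal) (n : ℕ) (m : Matrix (Fin 2) (Fin 2) (ZMod 2)) :
    bump n m * a = bump n (m * a.1.2 n) := by
  apply Subtype.ext
  refine Prod.ext (by simp [bump]) (funext fun k => ?_)
  by_cases h : k = n
  · subst h; simp [bump]
  · simp [bump, h]

lemma bump_add (n : ℕ) (a b : Matrix (Fin 2) (Fin 2) (ZMod 2)) :
    bump n (a + b) = bump n a + bump n b := by
  apply Subtype.ext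
  exact Prod.ext (by simp [bump]) (by simp [bump, Pi.single_add])

lemma bump_injective (n : ℕ) : Function.Injective (bump n) := fun a b h => by
  have := congrArg (fun z : eventuallyDiagonal => z.1.2 n) h
  simpa [bump] using this

@[simp] lemma bump_zero (n : ℕ) : bump n 0 = 0 := by
  apply Subtype.ext
  exact Prod.ext (by simp [bump]) (by simp [bump])

lemma bump_one_eq (n : ℕ) :
    bump n 1 = bump n (Matrix.single 0 0 1) + bump n (Matrix.single 1 1 1) := by
  rw [← bump_add]; congr 1; decide

lemma exists_eq_sum {z : eventuallyDiagonal} (hz : z.1.1 = 0) :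
    ∃ N, z = ∑ n ∈ Finset.range N, bump n 1 * z := by
  obtain ⟨N, hN⟩ := z.2
  refine ⟨N, Subtype.ext (Prod.ext ?_ (funext fun k => ?_))⟩
  · simp [hz, Prod.fst_sum, bump]
  · simp only [bump_mul, one_mul, AddSubmonoidClass.coe_finsetSum, Prod.snd_sum,
      Finset.sum_apply]
    simp only [bump, Pi.single_apply, Finset.sum_ite_eq, Finset.mem_range]
    split_ifs with h
    · rfl
    · rw [hN k (not_lt.mp h), hz]; simp

lemma exists_eq_mul_mul_self (a : eventuallyDiagonal) :
    ∃ x : eventuallyDiagonal, a = a * x * a := by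
  have key : ∀ m : Matrix (Fin 2) (Fin 2) (ZMod 2), ∃ x, m = m * x * m := by decide
  have diag : ∀ d : Fin 2 → ZMod 2, d = d * d * d := by decide
  classical
  choose g hg using key
  obtain ⟨N, hN⟩ := a.2
  refine ⟨⟨(a.1.1, fun n => if N ≤ n then Matrix.diagonal a.1.1 else g (a.1.2 n)), N,
    fun n hn => if_pos hn⟩, Subtype.ext (Prod.ext (diag _) (funext fun n => ?_))⟩
  by_cases h : N ≤ n
  · have := congrArg Matrix.diagonal (diag a.1.1)
    simpa [h, hN n h, Pi.mul_def] using this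
  · simpa [h] using hg (a.1.2 n)

end eventuallyDiagonal

lemma isSimpleModule_span_singleton {S M : Type*} [Ring S] [AddCommGroup M] [Module S M]
    {m : M} (hm : m ≠ 0) (h : ∀ r : S, r • m ≠ 0 → ∃ s : S, s • r • m = m) :
    IsSimpleModule S (Submodule.span S {m}) := by
  rw [isSimpleModule_iff_isAtom]
  refine ⟨by simpa using hm, fun N hN => ?_⟩
  by_contra hN0
  obtain ⟨v, hv, hv0⟩ := N.ne_bot_iff.mp hN0
  obtain ⟨r, rfl⟩ := Submodule.mem_span_singleton.mp (hN.le hv)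
  obtain ⟨s, hs⟩ := h r hv0
  refine hN.not_ge ?_
  rw [Submodule.span_singleton_le_iff_mem, ← hs]
  exact N.smul_mem s hv

namespace eventuallyDiagonal

section Module

variable {M : Type*} [AddCommGroup M] [Module eventuallyDiagonalᵐᵒᵖ M]

lemma isSimpleModule_span_bump_smul (n : ℕ) (i : Fin 2) (m : M)
    (hm : op (bump n (Matrix.single i i 1)) • m ≠ 0) :
    IsSimpleModule eventuallyDiagonalᵐᵒᵖ
      (Submodule.span eventuallyDiagonalᵐᵒᵖ {op (bump n (Matrix.single i i 1)) • m}) := by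
  have key : ∀ (i : Fin 2) (a : Matrix (Fin 2) (Fin 2) (ZMod 2)), Matrix.single i i 1 * a ≠ 0 →
      ∃ s, Matrix.single i i 1 * a * s = Matrix.single i i 1 := by decide
  refine isSimpleModule_span_singleton hm fun r hr => ?_
  induction r using MulOpposite.rec' with | h r => ?_
  rw [smul_smul, ← op_mul, bump_mul] at hr ⊢
  obtain ⟨s, hs⟩ := key i (r.1.2 n) fun h => hr (by simp [h])
  refine ⟨op (bump n s), ?_⟩
  rw [smul_smul, ← op_mul, bump_mul]
  simp [bump, hs]

lemma smul_eq_zero_of_fst_eq_zero {m : M} (h : ∀ n, op (bump n 1) • m = 0)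
    {z : eventuallyDiagonal} (hz : z.1.1 = 0) : op z • m = 0 := by
  obtain ⟨N, hN⟩ := exists_eq_sum hz
  rw [hN, Finset.op_sum, Finset.sum_smul]
  exact Finset.sum_eq_zero fun n _ => by rw [op_mul, mul_smul, h, smul_zero]

lemma smul_eq_smul_of_fst_eq {m : M} (h : ∀ n, op (bump n 1) • m = 0)
    {z w : eventuallyDiagonal} (hzw : z.1.1 = w.1.1) : op z • m = op w • m := by
  rw [← sub_eq_zero, ← sub_smul, ← op_sub]
  exact smul_eq_zero_of_fst_eq_zero h (by simp [hzw])

lemma isSimpleModule_span_const_smul (i : Fin 2) (m : M) (h : ∀ n, op (bump n 1) • m = 0)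
    (hm : op (const (Pi.single i 1)) • m ≠ 0) :
    IsSimpleModule eventuallyDiagonalᵐᵒᵖ
      (Submodule.span eventuallyDiagonalᵐᵒᵖ {op (const (Pi.single i 1)) • m}) := by
  have key : ∀ (i : Fin 2) (a : Fin 2 → ZMod 2), Pi.single i 1 * a = 0 ∨
      Pi.single i 1 * a = Pi.single i 1 := by decide
  refine isSimpleModule_span_singleton hm fun r hr => ⟨1, ?_⟩
  induction r using MulOpposite.rec' with | h r => ?_
  rw [smul_smul, ← op_mul] at hr
  rw [one_smul, smul_smul, ← op_mul]
  rcases key i r.1.1 with h0 | h1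
  · exact absurd (smul_eq_zero_of_fst_eq_zero h h0) hr
  · exact smul_eq_smul_of_fst_eq h h1

end Module

lemma rightSemiartinian : RightSemiartinian eventuallyDiagonal := by
  intro M _ _ hM
  by_cases h : ∀ (m : M) n, op (bump n 1) • m = 0
  · obtain ⟨m, hm⟩ := exists_ne (0 : M)
    have hsum : const (Pi.single 0 1) + const (Pi.single 1 1) = 1 := by
      refine Subtype.ext (Prod.ext ?_ (funext fun n => ?_))
      · change (Pi.single 0 1 + Pi.single 1 1 : Fin 2 → ZMod 2) = 1
        decide
      · change Matrix.diagonal (Pi.single 0 1 : Fin 2 → ZMod 2) +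
          Matrix.diagonal (Pi.single 1 1) = 1
        decide
    by_cases h0 : op (const (Pi.single 0 1)) • m = 0
    · refine ⟨_, isSimpleModule_span_const_smul 1 m (h m) fun h1 => hm ?_⟩
      rw [← one_smul eventuallyDiagonalᵐᵒᵖ m, ← op_one, ← hsum, op_add, add_smul, h0, h1,
        add_zero]
    · exact ⟨_, isSimpleModule_span_const_smul 0 m (h m) h0⟩
  · push Not at h
    obtain ⟨m, n, hm⟩ := h
    by_cases h0 : op (bump n (Matrix.single 0 0 1)) • m = 0
    · refine ⟨_, isSimpleModule_span_bump_smul n 1 m fun h1 => hm ?_⟩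
      rw [bump_one_eq, op_add, add_smul, h0, h1, add_zero]
    · exact ⟨_, isSimpleModule_span_bump_smul n 0 m h0⟩

/-- The limit of an eventually diagonal sequence, as a ring homomorphism. -/
def limit : eventuallyDiagonalᵐᵒᵖ →+* (Fin 2 → ZMod 2) where
  toFun a := a.unop.1.1
  map_one' := rfl
  map_zero' := rfl
  map_mul' _ _ := mul_comm _ _
  map_add' _ _ := rfl

lemma limit_surjective : Function.Surjective limit := fun d => ⟨op (const d), rfl⟩

lemma rightSocle_eq : rightSocle eventuallyDiagonal = RingHom.ker limit := by
  apply le_antisymm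
  · refine sSup_le fun I hI => ?_
    by_contra hle
    have hinf : I ⊓ RingHom.ker limit = ⊥ := hI.2 _ (inf_lt_left.mpr hle)
    obtain ⟨a, ha, ha0⟩ := I.ne_bot_iff.mp hI.1
    have hne : ∀ n, a.unop.1.2 n = 0 := fun n => by
      have hmem : op (bump n 1) * a ∈ I ⊓ RingHom.ker limit :=
        ⟨I.mul_mem_left _ ha, (map_mul limit _ _).trans (zero_mul _)⟩
      rw [hinf, Submodule.mem_bot, ← op_unop a, ← op_mul, mul_bump, op_eq_zero_iff, mul_one,
        ← bump_zero n] at hmem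
      exact bump_injective n hmem
    refine ha0 (unop_injective (Subtype.ext (Prod.ext ?_ (funext hne))))
    obtain ⟨N, hN⟩ := a.unop.2
    have := hN N le_rfl
    rw [hne] at this
    exact Matrix.diagonal_injective (by rw [← this]; simp)
  · intro a ha
    obtain ⟨N, hN⟩ := exists_eq_sum (z := a.unop) ha
    rw [← op_unop a, hN, Finset.op_sum]
    refine sum_mem fun n _ => ?_
    have key (i : Fin 2) :
        op (bump n (Matrix.single i i 1)) ∈ rightSocle eventuallyDiagonal := by
      have hs := isSimpleModule_span_bump_smul n i (1 : eventuallyDiagonalᵐᵒᵖ) (by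
        rw [smul_eq_mul, mul_one, Ne, op_eq_zero_iff, ← bump_zero n]
        intro h
        have := congrFun (congrFun (bump_injective n h) i) i
        simp at this)
      rw [isSimpleModule_iff_isAtom, smul_eq_mul, mul_one] at hs
      exact le_sSup (α := Ideal eventuallyDiagonalᵐᵒᵖ) hs
        (Submodule.mem_span_singleton_self _)
    rw [op_mul, bump_one_eq, op_add]
    exact Ideal.mul_mem_left _ _ (add_mem (key 0) (key 1))

lemma rightSocle_ne_top : rightSocle eventuallyDiagonal ≠ ⊤ := by
  rw [rightSocle_eq]
  exact RingHom.ker_ne_top limit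

lemma isSemisimpleModule_quotient_rightSocle :
    IsSemisimpleModule eventuallyDiagonalᵐᵒᵖ
      (eventuallyDiagonalᵐᵒᵖ ⧸ rightSocle eventuallyDiagonal) := by
  rw [rightSocle_eq]
  have : RingHomSurjective limit := ⟨limit_surjective⟩
  let l : eventuallyDiagonalᵐᵒᵖ →ₛₗ[limit] (Fin 2 → ZMod 2) :=
    { toFun := limit, map_add' := map_add limit, map_smul' := map_mul limit }
  have hl : ∀ a, a ∈ RingHom.ker limit → l a = 0 := fun a ha => ha
  refine (LinearMap.isSemisimpleModule_iff_of_bijective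
    (Submodule.liftQ (RingHom.ker limit) l hl) ⟨?_, ?_⟩).mpr inferInstance
  · rw [← LinearMap.ker_eq_bot]
    exact Submodule.ker_liftQ_eq_bot _ _ _ fun a ha => ha
  · exact fun d => ⟨Submodule.Quotient.mk (op (const d)), rfl⟩

lemma isArtinian_quotient_of_finite {S α : Type*} [Ring S] [Finite α] (φ : S → α) (I : Ideal S)
    (h : ∀ a b, φ a = φ b → a - b ∈ I) : IsArtinian S (S ⧸ I) := by
  have : Finite (S ⧸ I) := by
    refine Finite.of_injective (fun q : S ⧸ I => φ (Quotient.out q)) fun p q hpq => ?_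
    rw [← Quotient.out_eq p, ← Quotient.out_eq q]
    exact (Submodule.Quotient.eq I).mpr (h _ _ hpq)
  infer_instance

lemma isArtinian_quotient_annihilator (U : Type*) [AddCommGroup U]
    [Module eventuallyDiagonalᵐᵒᵖ U] [IsSimpleModule eventuallyDiagonalᵐᵒᵖ U] :
    IsArtinian eventuallyDiagonalᵐᵒᵖ
      (eventuallyDiagonalᵐᵒᵖ ⧸ Module.annihilator eventuallyDiagonalᵐᵒᵖ U) := by
  by_cases h : ∀ (u : U) n, op (bump n 1) • u = 0
  · refine isArtinian_quotient_of_finite limit _ fun a b hab => ?_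
    rw [Module.mem_annihilator]
    intro u
    exact smul_eq_zero_of_fst_eq_zero (h u) (z := (a - b).unop) (sub_eq_zero.mpr hab)
  · push Not at h
    obtain ⟨u, n, hu⟩ := h
    refine isArtinian_quotient_of_finite (fun a => a.unop.1.2 n) _ fun a b hab => ?_
    rw [Module.mem_annihilator]
    intro v
    obtain ⟨r, rfl⟩ := IsSimpleModule.toSpanSingleton_surjective eventuallyDiagonalᵐᵒᵖ hu v
    rw [LinearMap.toSpanSingleton_apply, smul_smul, smul_smul]
    have : (a - b) * r * op (bump n 1) = 0 := by
      apply unop_injective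
      simp only [unop_mul, unop_op, unop_sub, unop_zero]
      rw [← mul_assoc, bump_mul, bump_mul, ← bump_zero n]
      have h0 : (a.unop - b.unop).1.2 n = 0 := sub_eq_zero.mpr hab
      rw [h0, mul_zero]
    rw [this, zero_smul]

lemma not_rightIdealSubiso {i j : Fin 2} (hij : i ≠ j) {e : eventuallyDiagonal}
    (he : e.1.1 = 1) {x y : eventuallyDiagonal} (hx : x = const (Pi.single i 1))
    (hy : y = const (Pi.single j 1)) :
    ¬ RightIdealSubiso eventuallyDiagonal (Ideal.span {op (e * x)})
      (Ideal.span {op (e * y)}) := by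
  rintro ⟨f, hf⟩
  let p : ↥(Ideal.span {op (e * x)}) := ⟨op (e * x), Submodule.mem_span_singleton_self _⟩
  have hxx : x * x = x := by
    refine Subtype.ext (Prod.ext ?_ (funext fun n => ?_))
    · simp [hx, const, ← Pi.single_mul]
    · simp [hx, const, ← Pi.single_mul_left_apply]
  have hp : op x • p = p := Subtype.ext (by
    change op x * op (e * x) = op (e * x)
    rw [← op_mul, mul_assoc, hxx])
  obtain ⟨r, hr⟩ := Ideal.mem_span_singleton'.mp (f p).2
  have hw : ((f p : eventuallyDiagonalᵐᵒᵖ)).unop.1.1 = 0 := by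
    have h1 : op x * (f p : eventuallyDiagonalᵐᵒᵖ) = f p := by
      conv_rhs => rw [← hp, map_smul]
      rfl
    rw [← h1, ← hr, hx, hy]
    funext k
    have : (Pi.single j 1 : Fin 2 → ZMod 2) k * (Pi.single i 1 : Fin 2 → ZMod 2) k = 0 := by
      by_cases hk : k = i
      · rw [Pi.single_eq_of_ne (hk ▸ hij), zero_mul]
      · rw [Pi.single_eq_of_ne hk, mul_zero]
    change e.1.1 k * (Pi.single j 1 : Fin 2 → ZMod 2) k * r.unop.1.1 k *
      (Pi.single i 1 : Fin 2 → ZMod 2) k = 0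
    rw [mul_assoc, mul_comm (r.unop.1.1 k), ← mul_assoc, mul_assoc (e.1.1 k), this, mul_zero,
      zero_mul]
  obtain ⟨N, hN⟩ := ((f p : eventuallyDiagonalᵐᵒᵖ)).unop.2
  obtain ⟨N', hN'⟩ := (e * x).2
  let n := max N N'
  have hz : op (bump n 1) • p = 0 := by
    apply hf
    rw [map_zero, map_smul]
    refine Subtype.ext (unop_injective ?_)
    change (f p : eventuallyDiagonalᵐᵒᵖ).unop * bump n 1 = 0
    rw [mul_bump, hN n (le_max_left _ _), hw]
    simp
  have hz' : e * x * bump n 1 = 0 := congrArg (fun q => q.1.unop) hz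
  rw [mul_bump, mul_one, ← bump_zero n] at hz'
  have h2 := bump_injective n hz'
  rw [hN' n (le_max_right _ _)] at h2
  have h3 := congrFun (congrFun h2 i) i
  have h4 : (e * x).1.1 i = e.1.1 i * (Pi.single i 1 : Fin 2 → ZMod 2) i := by rw [hx]; rfl
  rw [Matrix.diagonal_apply_eq, h4, he] at h3
  simp at h3

lemma fst_eq_zero_or_one {e : eventuallyDiagonal} (he : e ∈ Set.center eventuallyDiagonal) :
    e.1.1 = 0 ∨ e.1.1 = 1 := by
  obtain ⟨N, hN⟩ := e.2
  have h := (Set.mem_center_iff.mp he).comm (bump N (Matrix.single 0 1 1))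
  rw [commute_iff_eq, mul_bump, bump_mul, hN N le_rfl] at h
  have h := bump_injective N h
  generalize e.1.1 = d at h
  revert d
  decide

end eventuallyDiagonal

/-- there is a von Neumann regular, right semiartinian ring of Loewy length
exactly 2 (`Soc(R_R) ≠ R` and `R/Soc(R_R)` semisimple), with all primitive factor rings right
artinian (for every simple right module `U`, `R/ann U` is artinian as a right `R`-module),
which does not satisfy the general comparability axiom. -/
theorem exists_ring_without_general_comparability :
    ∃ (R : Type) (_ : Ring R),
      (∀ a : R, ∃ x : R, a = a * x * a) ∧
      RightSemiartinian R ∧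
      rightSocle R ≠ ⊤ ∧
      IsSemisimpleModule Rᵐᵒᵖ (Rᵐᵒᵖ ⧸ rightSocle R) ∧
      (∀ (U : Type) (_ : AddCommGroup U) (_ : Module Rᵐᵒᵖ U), IsSimpleModule Rᵐᵒᵖ U →
        IsArtinian Rᵐᵒᵖ (Rᵐᵒᵖ ⧸ Module.annihilator Rᵐᵒᵖ U)) ∧
      (∃ x y : R, ∀ e : R, IsIdempotentElem e → e ∈ Set.center R →
        ¬(RightIdealSubiso R (Ideal.span {op (e * x)}) (Ideal.span {op (e * y)}) ∧
          RightIdealSubiso R (Ideal.span {op ((1 - e) * y)})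
            (Ideal.span {op ((1 - e) * x)}))) := by
  refine ⟨eventuallyDiagonal, inferInstance, eventuallyDiagonal.exists_eq_mul_mul_self,
    eventuallyDiagonal.rightSemiartinian, eventuallyDiagonal.rightSocle_ne_top,
    eventuallyDiagonal.isSemisimpleModule_quotient_rightSocle,
    fun U _ _ _ => eventuallyDiagonal.isArtinian_quotient_annihilator U,
    eventuallyDiagonal.const (Pi.single 0 1), eventuallyDiagonal.const (Pi.single 1 1),
    fun e _ he h => ?_⟩
  rcases eventuallyDiagonal.fst_eq_zero_or_one he with h0 | h1
  · refine eventuallyDiagonal.not_rightIdealSubiso (by decide) ?_ rfl rfl h.2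
    change 1 - e.1.1 = 1
    rw [h0, sub_zero]
  · exact eventuallyDiagonal.not_rightIdealSubiso (by decide) h1 rfl rfl h.1
end

section
/- There exists a ring R with the following properties: (i) R is unit-regular; (ii) R is right semiartinian; (iii) R is right hereditary and left hereditary; (iv) R has exactly three right primitive ideals and they form a chain P₀ ⊊ P₁ ⊊ P₂; (v) every simple right R-module whose annihilator is P₁ or P₂ is injective as a right R-module, while every simple right R-module whose annihilator is P₀ is not injective. -/
open MulOpposite

/-- The set of right primitive ideals of `R`: annihilators of simple right `R`-modules. -/
def primIdeals (R : Type) [Ring R] : Set (Ideal Rᵐᵒᵖ) :=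
  {P | ∃ (U : Type) (_ : AddCommGroup U) (_ : Module Rᵐᵒᵖ U),
    IsSimpleModule Rᵐᵒᵖ U ∧ P = Module.annihilator Rᵐᵒᵖ U}



open CategoryTheory in
theorem exists_injective_embedding {A : Type} [Ring A] (M : Type) [AddCommGroup M] [Module A M] :
    ∃ (E : Type) (_ : AddCommGroup E) (_ : Module A E) (i : M →ₗ[A] E),
      Module.Injective A E ∧ Function.Injective i := by
  obtain ⟨J⟩ := EnoughInjectives.presentation (ModuleCat.of A M)
  have hJ : CategoryTheory.Injective (ModuleCat.of A J.J) := J.injective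
  exact ⟨J.J, inferInstance, inferInstance, J.f.hom,
    Module.injective_module_of_injective_object A J.J, (ModuleCat.mono_iff_injective J.f).1 J.mono⟩

/-- A spanning family can be mapped anywhere, provided its linear relations are preserved. -/
theorem exists_linearMap_of_relations {R X M ι : Type*} [Ring R] [AddCommGroup X] [Module R X]
    [AddCommGroup M] [Module R M] (x : ι → X) (m : ι → M)
    (hspan : Submodule.span R (Set.range x) = ⊤)
    (hrel : ∀ c : ι →₀ R, Finsupp.linearCombination R x c = 0 →
      Finsupp.linearCombination R m c = 0) :
    ∃ ψ : X →ₗ[R] M, ∀ i, ψ (x i) = m i := by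
  have hsurj : Function.Surjective (Finsupp.linearCombination R x) := by
    rw [← LinearMap.range_eq_top, Finsupp.range_linearCombination, hspan]
  refine ⟨(Submodule.liftQ _ (Finsupp.linearCombination R m) hrel) ∘ₗ
    ((Finsupp.linearCombination R x).quotKerEquivOfSurjective hsurj).symm.toLinearMap, fun i => ?_⟩
  have : ((Finsupp.linearCombination R x).quotKerEquivOfSurjective hsurj).symm (x i)
      = Submodule.Quotient.mk (Finsupp.single i 1) := by
    rw [LinearEquiv.symm_apply_eq]
    simp [LinearMap.quotKerEquivOfSurjective]
  rw [LinearMap.comp_apply, LinearEquiv.coe_coe, this]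
  erw [Submodule.liftQ_apply]
  simp

theorem injective_quotient {A : Type} [Ring A] (hA : ∀ I : Ideal A, Module.Projective A I)
    {E : Type} [AddCommGroup E] [Module A E] (hE : Module.Injective A E) (L : Submodule A E) :
    Module.Injective A (E ⧸ L) := by
  apply Module.Baer.injective
  intro I g
  have := hA I
  obtain ⟨h, hh⟩ := Module.projective_lifting_property L.mkQ g L.mkQ_surjective
  obtain ⟨k, hk⟩ := hE.out I.subtype I.injective_subtype h
  refine ⟨L.mkQ ∘ₗ k, fun x hx => ?_⟩
  have := hk ⟨x, hx⟩
  simp only [Submodule.subtype_apply] at this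
  rw [LinearMap.comp_apply, this, ← hh, LinearMap.comp_apply]

/-- Over a hereditary ring, submodules of projective modules are projective. -/
theorem projective_submodule {A : Type} [Ring A] (hA : ∀ I : Ideal A, Module.Projective A I)
    {P : Type} [AddCommGroup P] [Module A P] [Module.Projective A P] (N : Submodule A P) :
    Module.Projective A N := by
  apply Module.Projective.of_lifting_property
  intro M B _ _ _ _ f g hf
  obtain ⟨E, _, _, i, hE, hi⟩ := exists_injective_embedding (A := A) M
  set L := (LinearMap.ker f).map i
  have hQ := injective_quotient hA hE L
  let j : B →ₗ[A] E ⧸ L := (Submodule.mapQ _ L i (Submodule.le_comap_map i _)) ∘ₗ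
    (f.quotKerEquivOfSurjective hf).symm.toLinearMap
  have hj : ∀ m, j (f m) = L.mkQ (i m) := by
    intro m
    have : (f.quotKerEquivOfSurjective hf).symm (f m) = Submodule.Quotient.mk m := by
      rw [LinearEquiv.symm_apply_eq]
      simp [LinearMap.quotKerEquivOfSurjective]
    simp [j, this]
  obtain ⟨h, hh⟩ := hQ.out N.subtype N.injective_subtype (j ∘ₗ g)
  obtain ⟨k, hk⟩ := Module.projective_lifting_property L.mkQ h L.mkQ_surjective
  have key : ∀ n : N, ∃ m, i m = k n ∧ f m = g n := by
    intro n
    obtain ⟨m, hm⟩ := hf (g n)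
    have h1 : L.mkQ (k n) = L.mkQ (i m) := by
      rw [← hj, hm, ← LinearMap.comp_apply, hk]
      exact hh n
    rw [← sub_eq_zero, ← map_sub, Submodule.mkQ_apply, Submodule.Quotient.mk_eq_zero] at h1
    obtain ⟨y, hy, hy'⟩ := h1
    refine ⟨y + m, by rw [map_add, hy']; abel, ?_⟩
    rw [map_add, LinearMap.mem_ker.1 hy, zero_add, hm]
  let e := LinearEquiv.ofInjective i hi
  have hr : ∀ n : N, (k ∘ₗ N.subtype) n ∈ LinearMap.range i := fun n =>
    ⟨_, (key n).choose_spec.1⟩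
  refine ⟨e.symm.toLinearMap ∘ₗ (k ∘ₗ N.subtype).codRestrict _ hr, ?_⟩
  ext n
  obtain ⟨m, hm, hm'⟩ := key n
  rw [← hm', LinearMap.comp_apply]
  congr 1
  rw [LinearMap.comp_apply, LinearEquiv.coe_coe, LinearEquiv.symm_apply_eq]
  ext
  simp [e, hm]

/-- Finitely generated right ideals of a regular ring have left units. -/
theorem exists_left_unit {R ι : Type*} [Ring R] (hreg : ∀ a : R, ∃ b, a = a * b * a)
    (t : ι → R) (s : Finset ι) : ∃ q : ι → R, ∀ j ∈ s, (∑ k ∈ s, t k * q k) * t j = t j := by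
  classical
  induction s using Finset.induction_on with
  | empty => exact ⟨0, by simp⟩
  | insert a s ha ih =>
    obtain ⟨q, hq⟩ := ih
    set h := ∑ k ∈ s, t k * q k with hh
    obtain ⟨z, hz⟩ := hreg (t a - h * t a)
    refine ⟨fun k => if k = a then z - z * h else q k - q k * t a * (z - z * h), ?_⟩
    have hsum : ∑ k ∈ insert a s, t k * (if k = a then z - z * h else
        q k - q k * t a * (z - z * h)) = h + (t a - h * t a) * z * (1 - h) := by
      rw [Finset.sum_insert ha]
      have : ∑ k ∈ s, t k * (if k = a then z - z * h else q k - q k * t a * (z - z * h))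
          = ∑ k ∈ s, (t k * q k - t k * q k * (t a * (z - z * h))) := by
        refine Finset.sum_congr rfl fun k hk => ?_
        rw [if_neg (fun hka : k = a => ha (hka ▸ hk))]
        noncomm_ring
      rw [this, Finset.sum_sub_distrib, ← Finset.sum_mul, ← hh]
      simp only [if_true]
      noncomm_ring
    intro j hj
    rw [hsum]
    rcases Finset.mem_insert.1 hj with rfl | hj
    · calc _ = h * t j + (t j - h * t j) * z * (t j - h * t j) := by noncomm_ring
        _ = _ := by rw [← hz]; abel
    · rw [add_mul, mul_assoc _ (1 - h), sub_mul 1, one_mul, hq j hj]; simp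

/-- Finitely generated left ideals of a regular ring have right units. -/
theorem exists_right_unit {R ι : Type*} [Ring R] (hreg : ∀ a : R, ∃ b, a = a * b * a)
    (t : ι → R) (s : Finset ι) : ∃ q : ι → R, ∀ j ∈ s, t j * (∑ k ∈ s, q k * t k) = t j := by
  obtain ⟨q, hq⟩ := exists_left_unit (R := Rᵐᵒᵖ) (fun a => by
    obtain ⟨b, hb⟩ := hreg a.unop
    exact ⟨.op b, MulOpposite.unop_injective (by simpa [mul_assoc] using hb)⟩)
    (fun i => .op (t i)) s
  refine ⟨fun i => (q i).unop, fun j hj => ?_⟩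
  simpa using congrArg MulOpposite.unop (hq j hj)

section Corner

variable {A R : Type} [Ring A] [Ring R] (φ : A →ₙ+* R)

/-- The part `e • X` of an `R`-module `X`, where `e = φ 1`. -/
def fixedPart (X : Type) [AddCommGroup X] [Module R X] : AddSubgroup X where
  carrier := {x | φ 1 • x = x}
  add_mem' := by
    intro a b ha hb
    simp only [Set.mem_ofPred_eq] at *
    rw [smul_add, ha, hb]
  zero_mem' := by simp
  neg_mem' := by
    intro a ha
    simp only [Set.mem_ofPred_eq] at *
    rw [smul_neg, ha]

variable {X Y : Type} [AddCommGroup X] [Module R X] [AddCommGroup Y] [Module R Y]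

theorem mem_fixedPart {x : X} : x ∈ fixedPart φ X ↔ φ 1 • x = x := Iff.rfl

theorem smul_mem_fixedPart (a : A) (x : X) : φ a • x ∈ fixedPart φ X := by
  rw [mem_fixedPart, smul_smul, ← map_mul, one_mul]

instance : Module A (fixedPart φ X) where
  smul a x := ⟨φ a • (x : X), smul_mem_fixedPart φ a _⟩
  one_smul x := Subtype.ext x.2
  mul_smul a b x := Subtype.ext (by
    change φ (a * b) • (x : X) = φ a • φ b • (x : X)
    rw [map_mul, mul_smul])
  smul_zero a := Subtype.ext (smul_zero (φ a))
  smul_add a x y := Subtype.ext (smul_add (φ a) (x : X) y)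
  add_smul a b x := Subtype.ext (by
    change φ (a + b) • (x : X) = φ a • (x : X) + φ b • (x : X)
    rw [map_add, add_smul])
  zero_smul x := Subtype.ext (by
    change φ 0 • (x : X) = 0
    rw [map_zero, zero_smul])

theorem coe_smul_fixedPart (a : A) (x : fixedPart φ X) : ((a • x : fixedPart φ X) : X) =
    φ a • (x : X) := rfl

/-- The restriction of a linear map to the corner parts. -/
def fixedPartMap (f : X →ₗ[R] Y) : fixedPart φ X →ₗ[A] fixedPart φ Y where
  toFun x := ⟨f x, by rw [mem_fixedPart, ← map_smul, (mem_fixedPart φ).1 x.2]⟩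
  map_add' x y := Subtype.ext (by simp)
  map_smul' a x := Subtype.ext (by simp [coe_smul_fixedPart])

@[simp] theorem coe_fixedPartMap (f : X →ₗ[R] Y) (x : fixedPart φ X) :
    (fixedPartMap φ f x : Y) = f x := rfl

variable (hreg : ∀ a : R, ∃ b, a = a * b * a)
  (hrange : ∀ x, φ 1 * x * φ 1 = x → ∃ a, φ a = x)

include hreg hrange

theorem exists_extension_fixedPart (hgen : Submodule.span R (fixedPart φ X : Set X) = ⊤)
    (l : fixedPart φ X →ₗ[A] fixedPart φ Y) :
    ∃ ψ : X →ₗ[R] Y, ∀ x : fixedPart φ X, ψ x = l x := by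
  refine exists_linearMap_of_relations (fun x : fixedPart φ X => (x : X))
    (fun x => (l x : Y)) (by simpa using hgen) fun c hc => ?_
  rw [Finsupp.linearCombination_apply, Finsupp.sum] at hc ⊢
  obtain ⟨q, hq⟩ := exists_left_unit hreg (fun i => c i * φ 1) c.support
  have hee : φ 1 * φ 1 = φ 1 := by rw [← map_mul, one_mul]
  have hex : ∀ (i : fixedPart φ X), (c i * φ 1) • (i : X) = c i • (i : X) := fun i => by
    rw [mul_smul, (mem_fixedPart φ).1 i.2]
  have hel : ∀ (i : fixedPart φ X), (c i * φ 1) • (l i : Y) = c i • (l i : Y) := fun i => by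
    rw [mul_smul, (mem_fixedPart φ).1 (l i).2]
  have hk : ∀ k, φ 1 • q k • ∑ j ∈ c.support, (c j * φ 1) • (l j : Y) = 0 := by
    intro k
    choose a ha using fun j => hrange (φ 1 * q k * (c j * φ 1)) (by
      simp only [← mul_assoc, hee]; simp only [mul_assoc, hee])
    have h1 : ∑ j ∈ c.support, a j • j = 0 := by
      apply Subtype.ext
      simp only [AddSubgroup.val_finsetSum, coe_smul_fixedPart, ha, mul_smul, ← Finset.smul_sum]
      simp only [← mul_smul]
      simp only [hex, hc, smul_zero, ZeroMemClass.coe_zero]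
    have h2 := congrArg (fun z => (l z : Y)) h1
    simp only [map_sum, map_smul, AddSubgroup.val_finsetSum, coe_smul_fixedPart, ha, mul_smul,
      ← Finset.smul_sum, map_zero, ZeroMemClass.coe_zero] at h2
    simpa only [mul_smul] using h2
  calc ∑ j ∈ c.support, c j • (l j : Y)
      = ∑ j ∈ c.support, ((∑ k ∈ c.support, c k * φ 1 * q k) * (c j * φ 1)) • (l j : Y) := by
        refine Finset.sum_congr rfl fun j hj => ?_
        rw [hq j hj, hel]
    _ = (∑ k ∈ c.support, c k * φ 1 * q k) • ∑ j ∈ c.support, (c j * φ 1) • (l j : Y) := by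
        rw [Finset.smul_sum]
        exact Finset.sum_congr rfl fun j _ => mul_smul _ _ _
    _ = 0 := by
        rw [Finset.sum_smul]
        refine Finset.sum_eq_zero fun k _ => ?_
        rw [mul_smul, mul_smul, hk, smul_zero]

theorem projective_of_fixedPart (hgen : Submodule.span R (fixedPart φ X : Set X) = ⊤)
    [Module.Projective A (fixedPart φ X)] : Module.Projective R X := by
  apply Module.Projective.of_lifting_property
  intro M B _ _ _ _ f g hf
  have hf' : Function.Surjective (fixedPartMap φ f) := by
    intro b
    obtain ⟨m, hm⟩ := hf b
    refine ⟨⟨φ 1 • m, smul_mem_fixedPart φ 1 m⟩, Subtype.ext ?_⟩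
    rw [coe_fixedPartMap, map_smul, hm]
    exact b.2
  obtain ⟨l, hl⟩ := Module.projective_lifting_property _ (fixedPartMap φ g) hf'
  obtain ⟨ψ, hψ⟩ := exists_extension_fixedPart φ hreg hrange hgen l
  refine ⟨ψ, LinearMap.ext_on hgen fun x hx => ?_⟩
  rw [LinearMap.comp_apply, hψ ⟨x, hx⟩, ← coe_fixedPartMap, ← LinearMap.comp_apply, hl]
  rfl

end Corner

/-- The two-sided ideal generated by `e`, as an additive subgroup. -/
def sandwich {R : Type} [Ring R] (e : R) : AddSubgroup R :=
  AddSubgroup.closure {x | ∃ r s, x = r * e * s}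

theorem mul_mem_sandwich {R : Type} [Ring R] {e x : R} (r s : R) (hx : x ∈ sandwich e) :
    r * x * s ∈ sandwich e := by
  induction hx using AddSubgroup.closure_induction with
  | mem x hx =>
    obtain ⟨a, b, rfl⟩ := hx
    exact AddSubgroup.subset_closure ⟨r * a, b * s, by simp only [mul_assoc]⟩
  | zero => simp
  | add x y _ _ hx hy => rw [mul_add, add_mul]; exact add_mem hx hy
  | neg x _ hx => rw [mul_neg, neg_mul]; exact neg_mem hx

theorem hereditary_of_corner {A R : Type} [Ring A] [Ring R] (φ : A →ₙ+* R)
    (hreg : ∀ a : R, ∃ b, a = a * b * a)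
    (hrange : ∀ x, φ 1 * x * φ 1 = x → ∃ a, φ a = x)
    (hA : ∀ I : Ideal A, Module.Projective A I)
    (hP : Module.Projective A (fixedPart φ R))
    (hid : ∀ g : R, g * g = g → g ∈ sandwich (φ 1) ∨ 1 - g ∈ sandwich (φ 1)) (I : Ideal R) :
    Module.Projective R I := by
  have small : ∀ I : Ideal R, (∀ x ∈ I, x ∈ sandwich (φ 1)) → Module.Projective R I := by
    intro I hI
    have hinj : Function.Injective (fixedPartMap φ I.subtype) := by
      intro x y hxy
      apply Subtype.ext
      apply I.injective_subtype
      exact congrArg (fun z : fixedPart φ R => (z : R)) hxy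
    have := projective_submodule hA (LinearMap.range (fixedPartMap φ I.subtype))
    have : Module.Projective A (fixedPart φ I) :=
      Module.Projective.of_equiv (LinearEquiv.ofInjective _ hinj).symm
    refine projective_of_fixedPart φ hreg hrange ?_
    rw [eq_top_iff]
    rintro x -
    obtain ⟨z, hz⟩ := hreg x
    have hxz : (x : R) * z ∈ sandwich (φ 1) := by
      simpa using mul_mem_sandwich 1 z (hI x x.2)
    have : x = ((x : R) * z) • x := Subtype.ext hz
    rw [this]
    generalize (x : R) * z = w at hxz
    clear this
    induction hxz using AddSubgroup.closure_induction with
    | mem w hw =>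
      obtain ⟨a, b, rfl⟩ := hw
      rw [mul_assoc, mul_smul, mul_smul]
      exact Submodule.smul_mem _ _ (Submodule.subset_span (smul_mem_fixedPart φ 1 _))
    | zero => simp
    | add x y _ _ hx hy => rw [add_smul]; exact add_mem hx hy
    | neg x _ hx => rw [neg_smul]; exact neg_mem hx
  by_cases hI : ∀ x ∈ I, x ∈ sandwich (φ 1)
  · exact small I hI
  push Not at hI
  obtain ⟨x, hx, hxs⟩ := hI
  obtain ⟨z, hz⟩ := hreg x
  set g := z * x with hg
  have hgI : g ∈ I := I.mul_mem_left z hx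
  have hgg : g * g = g := by
    rw [hg, mul_assoc, ← mul_assoc x z x, ← hz]
  have hxg : x * g = x := by rw [hg, ← mul_assoc, ← hz]
  have hgs : 1 - g ∈ sandwich (φ 1) := by
    refine (hid g hgg).resolve_left fun h => hxs ?_
    have := mul_mem_sandwich x 1 h
    rwa [hxg, mul_one] at this
  let I' : Ideal R := I ⊓ LinearMap.ker (LinearMap.toSpanSingleton R R g)
  have hmem : ∀ y, y ∈ I' ↔ y ∈ I ∧ y * g = 0 := fun y => by simp [I']
  have hI' : Module.Projective R I' := small I' fun y hy => by
    have := mul_mem_sandwich y 1 hgs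
    rwa [mul_sub, mul_one, ((hmem y).1 hy).2, sub_zero, mul_one] at this
  let p : R × I' →ₗ[R] I := LinearMap.coprod (LinearMap.toSpanSingleton R I ⟨g, hgI⟩)
    (Submodule.inclusion inf_le_left)
  let s : I →ₗ[R] R × I' := LinearMap.prod I.subtype
    { toFun := fun y => ⟨y - y * g, (hmem _).2 ⟨sub_mem y.2 (I.mul_mem_left _ hgI), by
        rw [sub_mul, mul_assoc, hgg, sub_self]⟩⟩
      map_add' := fun y z => Subtype.ext (by simp; noncomm_ring)
      map_smul' := fun a y => Subtype.ext (by simp; noncomm_ring) }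
  refine Module.Projective.of_split s p ?_
  ext y
  simp [s, p]

/-- The inclusion of a corner ring. -/
def cornerInclusion {R : Type} [Ring R] {e : R} (he : IsIdempotentElem e) : he.Corner →ₙ+* R where
  toFun x := x.1
  map_mul' _ _ := rfl
  map_zero' := rfl
  map_add' _ _ := rfl

section

variable {R : Type} [Ring R] {e : R} (he : IsIdempotentElem e)

theorem cornerInclusion_one : cornerInclusion he 1 = e := rfl

theorem cornerInclusion_injective : Function.Injective (cornerInclusion he) :=
  Subtype.val_injective

theorem mul_cornerInclusion (x : he.Corner) : e * cornerInclusion he x = cornerInclusion he x :=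
  ((Subsemigroup.mem_corner_iff he).1 x.2).1

theorem cornerInclusion_mul (x : he.Corner) : cornerInclusion he x * e = cornerInclusion he x :=
  ((Subsemigroup.mem_corner_iff he).1 x.2).2

theorem exists_cornerInclusion_eq (x : R) (h : e * x = x) (h' : x * e = x) :
    ∃ a, cornerInclusion he a = x :=
  ⟨⟨x, (Subsemigroup.mem_corner_iff he).2 ⟨h, h'⟩⟩, rfl⟩

theorem exists_cornerInclusion_eq_mul (x : R) : ∃ a, cornerInclusion he a = e * x * e :=
  exists_cornerInclusion_eq he _ (by simp only [← mul_assoc, he.eq])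
    (by simp only [mul_assoc, he.eq])

theorem cornerInclusion_surj (x : R)
    (h : cornerInclusion he 1 * x * cornerInclusion he 1 = x) :
    ∃ a, cornerInclusion he a = x := by
  obtain ⟨a, ha⟩ := exists_cornerInclusion_eq_mul he x
  exact ⟨a, ha.trans h⟩

theorem projective_of_division {A : Type} [Ring A] (h0 : (1 : A) ≠ 0)
    (hdiv : ∀ x : A, x = 0 ∨ ∃ y, y * x = 1 ∧ x * y = 1) (X : Type)
    [AddCommGroup X] [Module A X] : Module.Projective A X := by
  have : Nontrivial A := ⟨1, 0, h0⟩
  let _ : DivisionRing A := DivisionRing.ofIsUnitOrEqZero fun a => by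
    rcases hdiv a with h | ⟨y, h1, h2⟩
    · exact .inr h
    · exact .inl ⟨⟨a, y, h2, h1⟩, rfl⟩
  infer_instance

end

theorem hereditary_of_idempotents {R : Type} [Ring R] {e f : R} (he : IsIdempotentElem e)
    (hreg : ∀ a : R, ∃ b, a = a * b * a)
    (hff : f * f = f) (hef : e * f = f) (hfe : f * e = f) (hf0 : f ≠ 0)
    (hdiv : ∀ x, f * x * f = 0 ∨ ∃ y, f * y * f * (f * x * f) = f ∧ f * x * f * (f * y * f) = f)
    (h2 : ∀ g, g * g = g → e * g = g → g * e = g → g ∈ sandwich f ∨ e - g ∈ sandwich f)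
    (h3 : ∀ g, g * g = g → g ∈ sandwich e ∨ 1 - g ∈ sandwich e)
    {B : Type} (x : B → R) (hx : ∀ b, e * x b = x b)
    (hli : ∀ a : B →₀ R, (∀ b, e * a b = a b) → (∀ b, a b * e = a b) →
      (a.sum fun b r => r * x b) = 0 → a = 0)
    (hspan : ∀ y, e * y = y → y ∈ AddSubgroup.closure {z | ∃ r b, z = e * r * e * x b})
    (I : Ideal R) : Module.Projective R I := by
  set φ := cornerInclusion he with hφ
  have hφ1 : φ 1 = e := rfl
  have hφi := cornerInclusion_injective he
  have hφe := mul_cornerInclusion he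
  have hφe' := cornerInclusion_mul he
  obtain ⟨f', hf'⟩ := exists_cornerInclusion_eq he f hef hfe
  have hf'i : IsIdempotentElem f' := hφi (by rw [map_mul, hf', hff])
  have hAreg : ∀ a : he.Corner, ∃ b, a = a * b * a := by
    intro a
    obtain ⟨b, hb⟩ := hreg (φ a)
    obtain ⟨b', hb'⟩ := exists_cornerInclusion_eq_mul he b
    refine ⟨b', hφi ?_⟩
    rw [map_mul, map_mul, hb', mul_assoc, mul_assoc (e * b), hφe, mul_assoc e, ← mul_assoc _ e,
      hφe', ← mul_assoc, ← hb]
  have hsand : ∀ a : he.Corner, φ a ∈ sandwich f → a ∈ sandwich f' := by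
    have key : ∀ y ∈ sandwich f, ∀ a : he.Corner, φ a = e * y * e → a ∈ sandwich f' := by
      intro y hy
      induction hy using AddSubgroup.closure_induction with
      | mem y hy =>
        obtain ⟨r, s, rfl⟩ := hy
        intro a ha
        obtain ⟨r', hr'⟩ := exists_cornerInclusion_eq_mul he r
        obtain ⟨s', hs'⟩ := exists_cornerInclusion_eq_mul he s
        refine AddSubgroup.subset_closure ⟨r', s', hφi ?_⟩
        rw [map_mul, map_mul, ← hφ, ha, hr', hs', hf', mul_assoc (e * r), hef]
        simp only [← mul_assoc]
        rw [mul_assoc (e * r) f e, hfe]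
      | zero =>
        intro a ha
        rw [hφi (ha.trans (by simp) : φ a = φ 0)]
        exact zero_mem _
      | add y z _ _ hy hz =>
        intro a ha
        obtain ⟨y', hy'⟩ := exists_cornerInclusion_eq_mul he y
        obtain ⟨z', hz'⟩ := exists_cornerInclusion_eq_mul he z
        rw [hφi (ha.trans (by rw [map_add, hy', hz']; noncomm_ring) : φ a = φ (y' + z'))]
        exact add_mem (hy _ hy') (hz _ hz')
      | neg y _ hy =>
        intro a ha
        obtain ⟨y', hy'⟩ := exists_cornerInclusion_eq_mul he y
        rw [hφi (ha.trans (by rw [map_neg, hy']; noncomm_ring) : φ a = φ (-y'))]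
        exact neg_mem (hy _ hy')
    intro a ha
    exact key _ ha a (by rw [hφe, hφe'])
  have hA : ∀ I : Ideal he.Corner, Module.Projective he.Corner I := by
    have hD := projective_of_division (A := hf'i.Corner) ?_ ?_
    rotate_left
    · intro h
      apply hf0
      rw [← hf', ← cornerInclusion_one hf'i, h, map_zero, map_zero]
    · intro d
      have hd : f * φ (cornerInclusion hf'i d) * f = φ (cornerInclusion hf'i d) := by
        rw [← hf', ← map_mul, ← map_mul, mul_cornerInclusion, cornerInclusion_mul]
      rcases hdiv (φ (cornerInclusion hf'i d)) with h | ⟨y, hy1, hy2⟩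
      · left
        rw [hd] at h
        exact cornerInclusion_injective hf'i (hφi (by rw [h, map_zero, map_zero]))
      · right
        rw [hd] at hy1 hy2
        obtain ⟨y', hy'⟩ := exists_cornerInclusion_eq he (f * y * f)
          (by simp only [← mul_assoc, hef]) (by simp only [mul_assoc, hfe])
        obtain ⟨y'', hy''⟩ := exists_cornerInclusion_eq hf'i y'
          (hφi (by rw [map_mul, hf', hy']; simp only [← mul_assoc, hff]))
          (hφi (by rw [map_mul, hf', hy']; simp only [mul_assoc, hff]))
        refine ⟨y'', cornerInclusion_injective hf'i (hφi ?_),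
          cornerInclusion_injective hf'i (hφi ?_)⟩
        · rw [map_mul, hy'', map_mul, hy', hy1, cornerInclusion_one, hf']
        · rw [map_mul, hy'', map_mul, hy', hy2, cornerInclusion_one, hf']
    refine hereditary_of_corner (cornerInclusion hf'i) hAreg
      (cornerInclusion_surj hf'i) (fun J => hD J)
      (hD _) fun g hg => ?_
    rw [cornerInclusion_one]
    refine (h2 (φ g) (by rw [← map_mul, hg]) (hφe g) (hφe' g)).imp (hsand g) fun h => ?_
    apply hsand
    rwa [map_sub, hφ1]
  have hP : Module.Projective he.Corner (fixedPart φ R) := by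
    let x' : B → fixedPart φ R := fun b => ⟨x b, hx b⟩
    have hli' : LinearIndependent he.Corner x' := by
      rw [linearIndependent_iff]
      intro l hl
      have := hli (l.mapRange φ (map_zero φ)) (fun b => by simpa using hφe (l b))
        (fun b => by simpa using hφe' (l b)) ?_
      · ext1 b
        apply hφi
        simpa using DFunLike.congr_fun this b
      · rw [Finsupp.sum_mapRange_index (by simp)]
        have h1 := congrArg (fun z : fixedPart φ R => (z : R)) hl
        rw [Finsupp.linearCombination_apply] at h1
        simpa [Finsupp.sum, coe_smul_fixedPart, x'] using h1
    have hsp : ⊤ ≤ Submodule.span he.Corner (Set.range x') := by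
      have key : ∀ y ∈ AddSubgroup.closure {z | ∃ r b, z = e * r * e * x b},
          ∃ z ∈ Submodule.span he.Corner (Set.range x'), (z : R) = y := by
        intro y hy
        induction hy using AddSubgroup.closure_induction with
        | mem y hy =>
          obtain ⟨r, b, rfl⟩ := hy
          obtain ⟨r', hr'⟩ := exists_cornerInclusion_eq_mul he r
          refine ⟨r' • x' b, Submodule.smul_mem _ _ (Submodule.subset_span ⟨b, rfl⟩), ?_⟩
          rw [coe_smul_fixedPart, ← hr', smul_eq_mul]
        | zero => exact ⟨0, zero_mem _, rfl⟩
        | add y z _ _ hy hz =>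
          obtain ⟨y', hy, rfl⟩ := hy
          obtain ⟨z', hz, rfl⟩ := hz
          exact ⟨_, add_mem hy hz, rfl⟩
        | neg y _ hy =>
          obtain ⟨y', hy, rfl⟩ := hy
          exact ⟨_, neg_mem hy, rfl⟩
      rintro y -
      obtain ⟨z, hz, hzy⟩ := key y (hspan y y.2)
      rwa [← Subtype.ext hzy]
    exact Module.Projective.of_basis (Module.Basis.mk hli' hsp)
  refine hereditary_of_corner φ hreg (cornerInclusion_surj he) hA hP (fun g hg => ?_) I
  rw [hφ1]
  exact h3 g hg


section Primitive

variable {B : Type} [Ring B]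

/-- The idempotent `e` is primitive modulo the two-sided ideal `J`, and generates the socle of the
primitive ring `B ⧸ J`. -/
structure IsPrimitiveLevel (J : Ideal B) (e : B) : Prop where
  mul_mem : ∀ x ∈ J, ∀ r, x * r ∈ J
  idem : e * e = e
  notMem : e ∉ J
  exists_inv : ∀ x, e * x * e ∈ J ∨ ∃ y, e * y * e * x * e - e ∈ J
  exists_mul : ∀ x, x ∉ J → ∃ r s, e * r * x * s * e ∉ J

variable {J : Ideal B} {e : B}
  {M : Type} [AddCommGroup M] [Module B M]

theorem IsPrimitiveLevel.isSimpleModule_span (h : IsPrimitiveLevel J e)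
    (hJ : ∀ x ∈ J, ∀ m : M, x • m = 0) {m : M} (hm : e • m ≠ 0) :
    IsSimpleModule B (Submodule.span B {e • m}) := by
  rw [isSimpleModule_iff_toSpanSingleton_surjective]
  have hmem : e • m ∈ Submodule.span B {e • m} := Submodule.mem_span_singleton_self _
  refine ⟨⟨⟨e • m, hmem⟩, 0, fun h0 => hm (congrArg Subtype.val h0)⟩, ?_⟩
  rintro ⟨z, hz⟩ hz0 ⟨w, hw⟩
  obtain ⟨r, rfl⟩ := Submodule.mem_span_singleton.1 hz
  obtain ⟨t, rfl⟩ := Submodule.mem_span_singleton.1 hw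
  have hr : r * e ∉ J := fun hr => hz0 (Subtype.ext
    ((smul_smul r e m).trans (hJ _ hr m)))
  obtain ⟨s, s', hs⟩ := h.exists_mul _ hr
  have hs' : e * (s * r) * e ∉ J := fun hh => hs (by
    have := h.mul_mem _ hh (s' * e)
    simpa only [mul_assoc] using this)
  obtain ⟨y, hy⟩ := (h.exists_inv (s * r)).resolve_left hs'
  have := hJ _ hy m
  rw [sub_smul, sub_eq_zero] at this
  refine ⟨t * (e * y * e * s), Subtype.ext ?_⟩
  change (t * (e * y * e * s)) • r • e • m = t • e • m
  conv_rhs => rw [← this]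
  simp only [smul_smul, mul_assoc]

theorem IsPrimitiveLevel.annihilator_eq (h : IsPrimitiveLevel J e)
    (hJ : J ≤ Module.annihilator B M) (he : e ∉ Module.annihilator B M) :
    Module.annihilator B M = J := by
  refine le_antisymm (fun x hx => ?_) hJ
  by_contra hxJ
  obtain ⟨r, s, hrs⟩ := h.exists_mul x hxJ
  obtain ⟨y, hy⟩ := (h.exists_inv (r * x * s)).resolve_left (by simpa only [mul_assoc] using hrs)
  refine he (Module.mem_annihilator.2 fun m => ?_)
  have h1 := Module.mem_annihilator.1 (hJ hy) m
  have h2 : (e * y * e * (r * x * s) * e) • m = 0 := by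
    have := Module.mem_annihilator.1 hx ((s * e) • m)
    rw [show e * y * e * (r * x * s) * e = (e * y * e * r) * (x * (s * e)) by
      simp only [mul_assoc], mul_smul, mul_smul x, this, smul_zero]
  rwa [sub_smul, h2, zero_sub, neg_eq_zero] at h1

theorem IsPrimitiveLevel.exists_simple (h : IsPrimitiveLevel J e) :
    ∃ (U : Type) (_ : AddCommGroup U) (_ : Module B U),
      IsSimpleModule B U ∧ J = Module.annihilator B U := by
  have hJ : ∀ x ∈ J, ∀ m : B ⧸ J, x • m = 0 := by
    intro x hx m
    obtain ⟨b, rfl⟩ := Submodule.mkQ_surjective J m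
    rw [← map_smul, Submodule.mkQ_apply, Submodule.Quotient.mk_eq_zero]
    exact h.mul_mem x hx b
  have hm : e • J.mkQ 1 ≠ 0 := by
    rw [← map_smul, Submodule.mkQ_apply, ne_eq, Submodule.Quotient.mk_eq_zero, smul_eq_mul,
      mul_one]
    exact h.notMem
  refine ⟨_, inferInstance, inferInstance, h.isSimpleModule_span hJ hm,
    (h.annihilator_eq ?_ ?_).symm⟩
  · exact fun x hx => Module.mem_annihilator.2 fun m => Subtype.ext (hJ x hx m)
  · intro he
    have := Module.mem_annihilator.1 he ⟨_, Submodule.mem_span_singleton_self (e • J.mkQ 1)⟩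
    have : e • e • J.mkQ 1 = 0 := congrArg Subtype.val this
    rw [smul_smul, h.idem] at this
    exact hm this

theorem smul_eq_zero_of_mem_sandwich {f : B} (hf : ∀ m : M, f • m = 0) {x : B}
    (hx : x ∈ sandwich f) (m : M) : x • m = 0 := by
  induction hx using AddSubgroup.closure_induction with
  | mem x hx =>
    obtain ⟨r, s, rfl⟩ := hx
    rw [mul_smul, mul_smul, hf, smul_zero]
  | zero => simp
  | add x y _ _ hx hy => rw [add_smul, hx, hy, add_zero]
  | neg x _ hx => rw [neg_smul, hx, neg_zero]

variable {P₁ P₂ : Ideal B} {f : B}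

theorem exists_simple_of_levels (h₀ : IsPrimitiveLevel ⊥ f) (h₁ : IsPrimitiveLevel P₁ e)
    (h₂ : IsPrimitiveLevel P₂ 1) (hf : ∀ x ∈ P₁, x ∈ sandwich f) (he : ∀ x ∈ P₂, x ∈ sandwich e)
    [Nontrivial M] : ∃ N : Submodule B M, IsSimpleModule B N := by
  by_cases hfM : ∀ m : M, f • m = 0
  · by_cases heM : ∀ m : M, e • m = 0
    · obtain ⟨m, hm⟩ := exists_ne (0 : M)
      exact ⟨_, h₂.isSimpleModule_span (fun x hx => smul_eq_zero_of_mem_sandwich heM (he x hx))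
        (by rwa [one_smul] : (1 : B) • m ≠ 0)⟩
    · push Not at heM
      obtain ⟨m, hm⟩ := heM
      exact ⟨_, h₁.isSimpleModule_span (fun x hx => smul_eq_zero_of_mem_sandwich hfM (hf x hx)) hm⟩
  · push Not at hfM
    obtain ⟨m, hm⟩ := hfM
    refine ⟨_, h₀.isSimpleModule_span (fun x hx => ?_) hm⟩
    rw [(Submodule.mem_bot B).1 hx]
    simp

theorem annihilator_mem_of_levels (h₀ : IsPrimitiveLevel ⊥ f) (h₁ : IsPrimitiveLevel P₁ e)
    (h₂ : IsPrimitiveLevel P₂ 1) (hf : ∀ x ∈ P₁, x ∈ sandwich f) (he : ∀ x ∈ P₂, x ∈ sandwich e)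
    [Nontrivial M] : Module.annihilator B M = ⊥ ∨ Module.annihilator B M = P₁ ∨
      Module.annihilator B M = P₂ := by
  by_cases hfM : f ∈ Module.annihilator B M
  · right
    rw [Module.mem_annihilator] at hfM
    by_cases heM : e ∈ Module.annihilator B M
    · rw [Module.mem_annihilator] at heM
      refine .inr (h₂.annihilator_eq (fun x hx => Module.mem_annihilator.2
        (smul_eq_zero_of_mem_sandwich heM (he x hx))) fun h1 => ?_)
      obtain ⟨m, hm⟩ := exists_ne (0 : M)
      exact hm (by simpa using Module.mem_annihilator.1 h1 m)
    · exact .inl (h₁.annihilator_eq (fun x hx => Module.mem_annihilator.2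
        (smul_eq_zero_of_mem_sandwich hfM (hf x hx))) heM)
  · exact .inl (h₀.annihilator_eq bot_le hfM)

theorem injective_of_maximal_level (hreg : ∀ a : B, ∃ b, a = a * b * a)
    (h : IsPrimitiveLevel J 1) (hJ : J ≤ Module.annihilator B M) : Module.Injective B M := by
  apply Module.Baer.injective
  intro I g
  have hg : ∀ x : I, (x : B) ∈ J → g x = 0 := by
    intro x hx
    obtain ⟨z, hz⟩ := hreg x
    have : x = ((x : B) * z) • x := Subtype.ext hz
    rw [this, map_smul]
    exact Module.mem_annihilator.1 (hJ (h.mul_mem _ hx z)) _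
  by_cases hI : ∀ x ∈ I, x ∈ J
  · exact ⟨0, fun x hx => (hg ⟨x, hx⟩ (hI x hx)).symm⟩
  push Not at hI
  obtain ⟨x, hx, hxJ⟩ := hI
  obtain ⟨y, hy⟩ := (h.exists_inv x).resolve_left (by simpa using hxJ)
  simp only [one_mul, mul_one] at hy
  set w : I := y • ⟨x, hx⟩ with hw
  refine ⟨LinearMap.toSpanSingleton B M (g w), fun z hz => ?_⟩
  rw [LinearMap.toSpanSingleton_apply, ← map_smul, ← sub_eq_zero, ← map_sub]
  apply hg
  have := J.mul_mem_left z hy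
  simpa [hw, mul_sub] using this

theorem not_injective_of_orthogonal [IsSimpleModule B M] (f : ℕ → B)
    (hf : ∀ n, f n ∈ J) (hff : ∀ n, f n * f n = f n)
    (horth : ∀ m n, m ≠ n → f m * f n = 0)
    (hright : ∀ x ∈ J, {n | x * f n ≠ 0}.Finite) (hleft : ∀ x ∈ J, ∃ n, f n * x = 0)
    (hM : ∀ n, ∃ m : M, f n • m ≠ 0) : ¬ Module.Injective B M := by
  intro hinj
  choose u hu using hM
  have hfin : ∀ x : J, (Function.support fun n => ((x : B) * f n) • u n).Finite := fun x =>
    (hright x x.2).subset fun n hn h0 => hn (by simp only [h0, zero_smul])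
  let F : J →ₗ[B] M :=
    { toFun := fun x => ∑ᶠ n, ((x : B) * f n) • u n
      map_add' := fun x y => by
        rw [← finsum_add_distrib (hfin x) (hfin y)]
        simp [add_mul, add_smul]
      map_smul' := fun b x => by
        rw [RingHom.id_apply, smul_finsum' b (hfin x)]
        simp [mul_assoc, mul_smul] }
  obtain ⟨h, hh⟩ := hinj.out J.subtype J.injective_subtype F
  have key : ∀ n, f n • h 1 = f n • u n := by
    intro n
    have h1 := hh ⟨f n, hf n⟩
    rw [← map_smul, smul_eq_mul, mul_one]
    refine h1.trans ?_
    change ∑ᶠ k, (f n * f k) • u k = _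
    rw [finsum_eq_single _ n, hff]
    intro k hk
    rw [horth n k hk.symm, zero_smul]
  have hne : f 0 • h 1 ≠ 0 := by rw [key]; exact hu 0
  obtain ⟨b, hb⟩ := IsSimpleModule.toSpanSingleton_surjective B hne (h 1)
  rw [LinearMap.toSpanSingleton_apply, smul_smul] at hb
  obtain ⟨n, hn⟩ := hleft _ (J.mul_mem_left b (hf 0))
  apply hu n
  rw [← key, ← hb, smul_smul, hn, zero_smul]

end Primitive

/-- Over a regular ring, the dual of a left module is an injective right module. -/
theorem injective_of_dual {R K V U : Type} [Ring R] [Field K] [AddCommGroup V] [Module K V]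
    [AddCommGroup U] [Module Rᵐᵒᵖ U] (hreg : ∀ a : R, ∃ b, a = a * b * a)
    (ρ : R →+* Module.End K V) (θ : U ≃+ Module.Dual K V)
    (hθ : ∀ (r : R) u v, θ (MulOpposite.op r • u) v = θ u (ρ r v)) :
    Module.Injective Rᵐᵒᵖ U := by
  apply Module.Baer.injective
  intro I g
  let x : I × V → V := fun p => ρ p.1.1.unop p.2
  have hxm : ∀ p, x p ∈ Submodule.span K (Set.range x) := fun p => Submodule.subset_span ⟨p, rfl⟩
  obtain ⟨ξ, hξ⟩ := exists_linearMap_of_relations (R := K)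
    (X := Submodule.span K (Set.range x)) (fun p => ⟨x p, hxm p⟩)
    (fun p => θ (g p.1) p.2) (by
      exact (Submodule.span_range_subtype_eq_top_iff _ hxm).2 rfl) (by
      intro c hc
      have hc := congrArg Subtype.val hc
      obtain ⟨q, hq⟩ := exists_right_unit (R := Rᵐᵒᵖ) (fun a => by
        obtain ⟨b, hb⟩ := hreg a.unop
        exact ⟨.op b, MulOpposite.unop_injective (by simpa [mul_assoc] using hb)⟩)
        (fun p : I × V => (p.1 : Rᵐᵒᵖ)) c.support
      set z : I := ∑ k ∈ c.support, q k • k.1 with hz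
      have hzv : (z : Rᵐᵒᵖ) = ∑ k ∈ c.support, q k * (k.1 : Rᵐᵒᵖ) := by simp [hz]
      have hgz : ∀ p ∈ c.support, θ (g p.1) p.2 = θ (g z) (x p) := by
        intro p hp
        have : p.1 = (p.1 : Rᵐᵒᵖ) • z := Subtype.ext (by
          rw [Submodule.coe_smul, hzv, smul_eq_mul, hq p hp])
        conv_lhs => rw [this, map_smul, ← MulOpposite.op_unop (p.1 : Rᵐᵒᵖ), hθ]
      rw [Finsupp.linearCombination_apply, Finsupp.sum] at hc ⊢
      rw [Finset.sum_congr rfl fun p hp => by rw [hgz p hp, ← map_smul], ← map_sum]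
      have : ∑ p ∈ c.support, c p • x p = 0 := by simpa using hc
      rw [this, map_zero])
  obtain ⟨ζ, hζ⟩ := LinearMap.exists_extend ξ
  refine ⟨LinearMap.toSpanSingleton Rᵐᵒᵖ U (θ.symm ζ), fun y hy => ?_⟩
  apply θ.injective
  ext v
  have h0 := hθ y.unop (θ.symm ζ) v
  rw [MulOpposite.op_unop, AddEquiv.apply_symm_apply] at h0
  refine h0.trans ?_
  have h1 := hξ (⟨y, hy⟩, v)
  rw [← hζ] at h1
  exact h1

section LocalUnit

/-- Idempotents acting as two-sided units on generators dominate the generated subgroup. -/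
theorem exists_localUnit_of_closure {B : Type*} [Ring B] {E G : Set B}
    (hE : ∀ p ∈ E, p * p = p)
    (h : ∀ p ∈ E, ∀ x ∈ G, ∃ p' ∈ E, p' * p = p ∧ p * p' = p ∧ p' * x = x ∧ x * p' = x)
    {x : B} (hx : x ∈ AddSubgroup.closure G) :
    ∀ p ∈ E, ∃ p' ∈ E, p' * p = p ∧ p * p' = p ∧ p' * x = x ∧ x * p' = x := by
  induction hx using AddSubgroup.closure_induction with
  | mem x hx => exact fun p hp => h p hp x hx
  | zero => exact fun p hp => ⟨p, hp, hE p hp, hE p hp, mul_zero p, zero_mul p⟩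
  | add x y _ _ hx hy =>
    intro p hp
    obtain ⟨p₁, hp₁, h1, h2, h3, h4⟩ := hx p hp
    obtain ⟨p₂, hp₂, k1, k2, k3, k4⟩ := hy p₁ hp₁
    refine ⟨p₂, hp₂, ?_, ?_, ?_, ?_⟩
    · rw [← h1, ← mul_assoc, k1]
    · rw [← h2, mul_assoc, k2]
    · rw [mul_add, k3, ← h3, ← mul_assoc, k1]
    · rw [add_mul, k4, ← h4, mul_assoc, k2]
  | neg x _ hx =>
    intro p hp
    obtain ⟨p₁, hp₁, h1, h2, h3, h4⟩ := hx p hp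
    exact ⟨p₁, hp₁, h1, h2, by rw [mul_neg, h3], by rw [neg_mul, h4]⟩

/-- Inner inverses that are units can be glued along a central decomposition of a commutant. -/
theorem exists_unit_of_corner {B : Type*} [Ring B] {x q t t' u u' : B} (hq : q * q = q)
    (hqt : q * t = t * q) (hqt' : q * t' = t' * q) (htt' : t * t' = 1) (ht't : t' * t = 1)
    (hx : x * t * x * (1 - q) = x * (1 - q)) (hqx : q * x = x * q)
    (hqu : q * u = u) (huq : u * q = u) (hqu' : q * u' = u') (huq' : u' * q = u')
    (huu' : u * u' = q) (hu'u : u' * u = q) (hxu : x * u * x = x * q) :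
    (t * (1 - q) + u) * (t' * (1 - q) + u') = 1 ∧ (t' * (1 - q) + u') * (t * (1 - q) + u) = 1 ∧
      x * (t * (1 - q) + u) * x = x := by
  have key : ∀ t t' u u' : B, q * t' = t' * q → t * t' = 1 → u * q = u → q * u' = u' →
      u * u' = q → (t * (1 - q) + u) * (t' * (1 - q) + u') = 1 := by
    intro t t' u u' h1 h2 h3 h4 h5
    have a1 : t * (1 - q) * (t' * (1 - q)) = 1 - q := by
      have : t * (1 - q) * (t' * (1 - q)) = t * (t' - q * t') * (1 - q) := by noncomm_ring
      rw [this, h1, show t * (t' - t' * q) * (1 - q) = (t * t') * (1 - q - q + q * q) by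
        noncomm_ring, h2, hq]
      noncomm_ring
    have a2 : t * (1 - q) * u' = 0 := by
      rw [mul_assoc, sub_mul, h4, one_mul, sub_self, mul_zero]
    have a3 : u * (t' * (1 - q)) = 0 := by
      rw [← h3, show u * q * (t' * (1 - q)) = u * (q * t') * (1 - q) by noncomm_ring, h1,
        show u * (t' * q) * (1 - q) = u * t' * (q - q * q) by noncomm_ring, hq, sub_self, mul_zero]
    rw [add_mul, mul_add, mul_add, a1, a2, a3, h5]
    noncomm_ring
  refine ⟨key t t' u u' hqt' htt' huq hqu' huu', key t' t u' u hqt ht't huq' hqu hu'u, ?_⟩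
  have : x * (t * (1 - q) + u) * x = x * t * (x - q * x) + x * u * x := by noncomm_ring
  rw [this, hqx, hxu, show x * t * (x - x * q) = x * t * x * (1 - q) by noncomm_ring, hx]
  noncomm_ring

end LocalUnit

section FiniteRank

variable {K V : Type*} [Field K] [AddCommGroup V] [Module K V]

/-- The rank-one operator `z ↦ w z • v`. -/
def rankOne (v : V) (w : Module.Dual K V) : Module.End K V := w.smulRight v

@[simp]
theorem rankOne_apply (v : V) (w : Module.Dual K V) (z : V) : rankOne v w z = w z • v := rfl

theorem mul_rankOne (g : Module.End K V) (v : V) (w : Module.Dual K V) :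
    g * rankOne v w = rankOne (g v) w := by
  ext z; simp

theorem rankOne_mul (g : Module.End K V) (v : V) (w : Module.Dual K V) :
    rankOne v w * g = rankOne v (w ∘ₗ g) := by
  ext z; simp

theorem rankOne_mul_rankOne (v v' : V) (w w' : Module.Dual K V) :
    rankOne v w * rankOne v' w' = w v' • rankOne v w' := by
  ext z; simp [smul_smul, mul_comm]

variable (K V) in
/-- The operators of finite rank. -/
def finiteRank : AddSubgroup (Module.End K V) :=
  AddSubgroup.closure {g | ∃ v w, g = rankOne v w}

theorem rankOne_mem (v : V) (w : Module.Dual K V) : rankOne v w ∈ finiteRank K V :=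
  AddSubgroup.subset_closure ⟨v, w, rfl⟩

theorem mul_mem_finiteRank (g : Module.End K V) {x : Module.End K V} (hx : x ∈ finiteRank K V) :
    g * x ∈ finiteRank K V := by
  induction hx using AddSubgroup.closure_induction with
  | mem x hx =>
    obtain ⟨v, w, rfl⟩ := hx
    rw [mul_rankOne]
    exact rankOne_mem _ _
  | zero => simp
  | add x y _ _ hx hy => rw [mul_add]; exact add_mem hx hy
  | neg x _ hx => rw [mul_neg]; exact neg_mem hx

theorem finiteRank_mul_mem (g : Module.End K V) {x : Module.End K V} (hx : x ∈ finiteRank K V) :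
    x * g ∈ finiteRank K V := by
  induction hx using AddSubgroup.closure_induction with
  | mem x hx =>
    obtain ⟨v, w, rfl⟩ := hx
    rw [rankOne_mul]
    exact rankOne_mem _ _
  | zero => simp
  | add x y _ _ hx hy => rw [add_mul]; exact add_mem hx hy
  | neg x _ hx => rw [neg_mul]; exact neg_mem hx

theorem finite_range {x : Module.End K V} (hx : x ∈ finiteRank K V) :
    Module.Finite K (LinearMap.range x) := by
  induction hx using AddSubgroup.closure_induction with
  | mem x hx =>
    obtain ⟨v, w, rfl⟩ := hx
    refine Submodule.finiteDimensional_of_le (S₂ := Submodule.span K {v}) ?_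
    rintro _ ⟨z, rfl⟩
    exact Submodule.smul_mem _ _ (Submodule.mem_span_singleton_self v)
  | zero => rw [LinearMap.range_zero]; infer_instance
  | add x y _ _ hx hy =>
    exact Submodule.finiteDimensional_of_le (LinearMap.range_add_le x y)
  | neg x _ hx => rwa [LinearMap.range_neg]

theorem one_notMem_finiteRank (hV : ¬ Module.Finite K V) :
    (1 : Module.End K V) ∉ finiteRank K V := by
  intro h
  have := finite_range h
  rw [Module.End.one_eq_id, LinearMap.range_id] at this
  exact hV (Module.Finite.equiv Submodule.topEquiv)

theorem exists_idempotent_fix_vector {p : Module.End K V} (hp : p ∈ finiteRank K V)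
    (hpp : p * p = p) (v : V) : ∃ p' ∈ finiteRank K V, p' * p' = p' ∧ p' * p = p ∧ p * p' = p ∧
      p' v = v := by
  have hpp' : ∀ z, p (p z) = p z := fun z => LinearMap.congr_fun hpp z
  by_cases hv : v - p v = 0
  · exact ⟨p, hp, hpp, hpp, hpp, (sub_eq_zero.1 hv).symm⟩
  obtain ⟨w, hw⟩ := Module.Projective.exists_dual_eq_one K hv
  rw [map_sub] at hw
  refine ⟨p + rankOne (v - p v) (w ∘ₗ (1 - p)), add_mem hp (rankOne_mem _ _), ?_, ?_, ?_, ?_⟩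
  · ext z; simp [hpp', hw]
  · ext z; simp [hpp']
  · ext z; simp [hpp']
  · simp [hw]

theorem exists_idempotent_fix_dual {p : Module.End K V} (hp : p ∈ finiteRank K V)
    (hpp : p * p = p) (w : Module.Dual K V) : ∃ p' ∈ finiteRank K V, p' * p' = p' ∧ p' * p = p ∧
      p * p' = p ∧ w ∘ₗ p' = w := by
  have hpp' : ∀ z, p (p z) = p z := fun z => LinearMap.congr_fun hpp z
  by_cases hw : w - w ∘ₗ p = 0
  · exact ⟨p, hp, hpp, hpp, hpp, (sub_eq_zero.1 hw).symm⟩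
  obtain ⟨v, hv⟩ : ∃ v, (w - w ∘ₗ p) v = 1 := by
    obtain ⟨v, hv⟩ := DFunLike.ne_iff.1 hw
    exact ⟨((w - w ∘ₗ p) v)⁻¹ • v, by rw [map_smul, smul_eq_mul]; exact inv_mul_cancel₀ hv⟩
  have hv' : w v - w (p v) = 1 := hv
  refine ⟨p + rankOne (v - p v) (w - w ∘ₗ p), add_mem hp (rankOne_mem _ _), ?_, ?_, ?_, ?_⟩
  · ext z; simp [hpp', hv']
  · ext z; simp [hpp']
  · ext z; simp [hpp']
  · ext z; simp [hv']

theorem exists_idempotent_fix {x : Module.End K V} (hx : x ∈ finiteRank K V) (p : Module.End K V)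
    (hp : p ∈ finiteRank K V) (hpp : p * p = p) : ∃ p' ∈ finiteRank K V, p' * p' = p' ∧
      p' * p = p ∧ p * p' = p ∧ p' * x = x ∧ x * p' = x := by
  obtain ⟨p', ⟨h1, h2⟩, h3⟩ := exists_localUnit_of_closure
    (E := {p : Module.End K V | p ∈ finiteRank K V ∧ p * p = p}) (fun p hp => hp.2) (by
      rintro p ⟨hp, hpp⟩ _ ⟨v, w, rfl⟩
      obtain ⟨p₁, hp₁, h1, h2, h3, h4⟩ := exists_idempotent_fix_vector hp hpp v
      obtain ⟨p₂, hp₂, k1, k2, k3, k4⟩ := exists_idempotent_fix_dual hp₁ h1 w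
      refine ⟨p₂, ⟨hp₂, k1⟩, ?_, ?_, ?_, ?_⟩
      · rw [← h2, ← mul_assoc, k2]
      · rw [← h3, mul_assoc, k3]
      · rw [mul_rankOne, ← h4, ← Module.End.mul_apply, k2]
      · rw [rankOne_mul, k4]) hx p ⟨hp, hpp⟩
  exact ⟨p', h1, h2, h3⟩

/-- Endomorphism rings of finite-dimensional spaces are unit-regular. -/
theorem exists_unit_inner_inverse [Module.Finite K V] (y : Module.End K V) :
    ∃ u u' : Module.End K V, u * u' = 1 ∧ u' * u = 1 ∧ y * u * y = y := by
  obtain ⟨C, hC⟩ := (LinearMap.ker y).exists_isCompl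
  obtain ⟨D, hD⟩ := (LinearMap.range y).exists_isCompl
  let e₁ : C ≃ₗ[K] LinearMap.range y := LinearMap.kerComplementEquivRange y hC.symm
  have hrank : Module.finrank K D = Module.finrank K (LinearMap.ker y) := by
    have h1 := LinearMap.finrank_range_add_finrank_ker y
    have h2 := Submodule.finrank_add_eq_of_isCompl hD
    omega
  let e₂ : D ≃ₗ[K] LinearMap.ker y := LinearEquiv.ofFinrankEq _ _ hrank
  let u : V ≃ₗ[K] V := (Submodule.prodEquivOfIsCompl _ _ hD).symm ≪≫ₗ (e₁.symm.prodCongr e₂) ≪≫ₗ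
    Submodule.prodEquivOfIsCompl _ _ hC.symm
  refine ⟨u.toLinearMap, u.symm.toLinearMap, ?_, ?_, ?_⟩
  · ext z; simp
  · ext z; simp
  · ext z
    have hu : ∀ r : LinearMap.range y, u r = e₁.symm r := fun r => by
      simp [u]
    change y (u (y z)) = y z
    rw [hu ⟨y z, z, rfl⟩]
    have := congrArg Subtype.val (e₁.apply_symm_apply ⟨y z, z, rfl⟩)
    exact this

theorem exists_unit_inner_inverse_corner {p y : Module.End K V} (hp : p ∈ finiteRank K V)
    (hpp : p * p = p) (hpy : p * y = y) (hyp : y * p = y) :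
    ∃ u u' : Module.End K V, p * u = u ∧ u * p = u ∧ p * u' = u' ∧ u' * p = u' ∧ u * u' = p ∧
      u' * u = p ∧ y * u * y = y := by
  obtain ⟨W, _, i, π, hi, hπ⟩ : ∃ (W : Submodule K V) (_ : Module.Finite K W) (i : W →ₗ[K] V)
      (π : V →ₗ[K] W), i ∘ₗ π = p ∧ π ∘ₗ i = LinearMap.id := by
    refine ⟨_, finite_range hp, (LinearMap.range p).subtype, p.rangeRestrict, rfl, ?_⟩
    ext ⟨_, z, rfl⟩
    exact LinearMap.congr_fun hpp z
  obtain ⟨u, u', h1, h2, h3⟩ := exists_unit_inner_inverse (π ∘ₗ y ∘ₗ i)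
  have hm : ∀ a b : Module.End K W,
      (i ∘ₗ a ∘ₗ π) * (i ∘ₗ b ∘ₗ π) = i ∘ₗ (a * b) ∘ₗ π := by
    intro a b
    ext z
    exact congrArg (fun t => i (a t)) (LinearMap.congr_fun hπ (b (π z)))
  have hp1 : p = i ∘ₗ (1 : Module.End K W) ∘ₗ π := hi.symm
  have hy : y = i ∘ₗ (π ∘ₗ y ∘ₗ i) ∘ₗ π := by
    conv_lhs => rw [← hyp, ← hpy, ← hi]
    rfl
  refine ⟨i ∘ₗ u ∘ₗ π, i ∘ₗ u' ∘ₗ π, ?_, ?_, ?_, ?_, ?_, ?_, ?_⟩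
  · conv_lhs => rw [hp1, hm, one_mul]
  · conv_lhs => rw [hp1, hm, mul_one]
  · conv_lhs => rw [hp1, hm, one_mul]
  · conv_lhs => rw [hp1, hm, mul_one]
  · rw [hm, h1, ← hp1]
  · rw [hm, h2, ← hp1]
  · rw [hy, hm, hm, h3]

end FiniteRank

section Blocks

variable {K V : Type*} [Field K] [AddCommGroup V] [Module K V]

/-- The direct sum of countably many copies of `V`. -/
def FreeSum (V : Type*) [AddCommGroup V] : Type _ := ℕ →₀ V

noncomputable instance : AddCommGroup (FreeSum V) := inferInstanceAs (AddCommGroup (ℕ →₀ V))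

noncomputable instance : Module K (FreeSum V) := inferInstanceAs (Module K (ℕ →₀ V))

namespace FreeSum

variable (K) in
/-- The inclusion of the `i`-th summand. -/
noncomputable def single (i : ℕ) : V →ₗ[K] FreeSum V := Finsupp.lsingle i

variable (K) in
/-- The projection onto the `j`-th summand. -/
noncomputable def coord (j : ℕ) : FreeSum V →ₗ[K] V := Finsupp.lapply j

theorem coord_single (i j : ℕ) (v : V) : coord K j (single K i v) = if i = j then v else 0 :=
  Finsupp.single_apply

theorem end_ext {x y : Module.End K (FreeSum V)} (h : ∀ k z, coord K k (x z) = coord K k (y z)) :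
    x = y :=
  LinearMap.ext fun z => Finsupp.ext fun k => h k z

end FreeSum

open FreeSum

/-- The operator on `FreeSum V` given by the matrix with `g` in position `(i, j)`, zero
elsewhere. -/
noncomputable def block (i j : ℕ) (g : Module.End K V) : Module.End K (FreeSum V) :=
  single K i ∘ₗ g ∘ₗ coord K j

/-- The operator on `FreeSum V` acting by `g` in every coordinate. -/
noncomputable def diagonal : Module.End K V →+* Module.End K (FreeSum V) where
  toFun g := Finsupp.mapRange.linearMap g
  map_one' := Finsupp.mapRange.linearMap_id
  map_mul' g g' := Finsupp.mapRange.linearMap_comp g g'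
  map_zero' := end_ext fun _ _ => rfl
  map_add' _ _ := end_ext fun _ _ => rfl

/-- The projection of `FreeSum V` onto its first `m` coordinates. -/
noncomputable def truncation (m : ℕ) : Module.End K (FreeSum V) :=
  ∑ i ∈ Finset.range m, block i i 1

theorem block_apply (i j : ℕ) (g : Module.End K V) (z : FreeSum V) :
    block i j g z = single K i (g (coord K j z)) := rfl

theorem coord_block (i j k : ℕ) (g : Module.End K V) (z : FreeSum V) :
    coord K k (block i j g z) = if i = k then g (coord K j z) else 0 :=
  coord_single _ _ _

theorem coord_diagonal (g : Module.End K V) (z : FreeSum V) (k : ℕ) :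
    coord K k (diagonal g z) = g (coord K k z) := rfl

theorem coord_truncation (m k : ℕ) (z : FreeSum V) :
    coord K k (truncation (K := K) m z) = if k < m then coord K k z else 0 := by
  simp [truncation, coord_block]

theorem block_add (i j : ℕ) (g g' : Module.End K V) :
    block i j (g + g') = block i j g + block i j g' := by
  rw [block, LinearMap.add_comp, LinearMap.comp_add]
  rfl

theorem block_neg (i j : ℕ) (g : Module.End K V) : block i j (-g) = -block i j g := by
  rw [block, LinearMap.neg_comp, LinearMap.comp_neg]
  rfl

@[simp]
theorem block_zero (i j : ℕ) : block i j (0 : Module.End K V) = 0 := by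
  rw [block, LinearMap.zero_comp, LinearMap.comp_zero]

theorem block_smul (i j : ℕ) (c : K) (g : Module.End K V) :
    block i j (c • g) = c • block i j g := by
  rw [block, LinearMap.smul_comp, LinearMap.comp_smul]
  rfl

theorem block_injective (i j : ℕ) : Function.Injective (block (K := K) (V := V) i j) := by
  intro g g' h
  ext v
  have := congrArg (coord K i) (LinearMap.congr_fun h (single K j v))
  simpa [coord_block, coord_single] using this

theorem block_mul_block (i j k : ℕ) (g g' : Module.End K V) :
    block i j g * block j k g' = block i k (g * g') :=
  end_ext fun l z => by simp [coord_block]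

theorem block_mul_block_of_ne {j k : ℕ} (hjk : j ≠ k) (i l : ℕ) (g g' : Module.End K V) :
    block i j g * block k l g' = 0 :=
  end_ext fun n z => by simp [coord_block, hjk.symm]

theorem diagonal_mul_block (i j : ℕ) (g g' : Module.End K V) :
    diagonal g * block i j g' = block i j (g * g') :=
  end_ext fun k z => by
    simp only [Module.End.mul_apply, coord_block, coord_diagonal]
    split_ifs <;> simp

theorem block_mul_diagonal (i j : ℕ) (g g' : Module.End K V) :
    block i j g * diagonal g' = block i j (g * g') :=
  end_ext fun k z => by simp [coord_block, coord_diagonal]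

theorem truncation_mul_truncation {m n : ℕ} (h : m ≤ n) :
    truncation m * truncation n = (truncation m : Module.End K (FreeSum V)) ∧
    truncation n * truncation m = (truncation m : Module.End K (FreeSum V)) := by
  constructor <;> refine end_ext fun k z => ?_ <;>
    simp only [Module.End.mul_apply, coord_truncation] <;> split_ifs <;> first | rfl | omega

theorem diagonal_mul_truncation (g : Module.End K V) (m : ℕ) :
    diagonal g * truncation m = truncation m * diagonal g :=
  end_ext fun k z => by
    simp only [Module.End.mul_apply, coord_truncation, coord_diagonal]
    split_ifs <;> simp

theorem truncation_mul_block {i m : ℕ} (h : i < m) (j : ℕ) (g : Module.End K V) :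
    truncation m * block i j g = block i j g :=
  end_ext fun k z => by
    simp only [Module.End.mul_apply, coord_truncation, coord_block]
    split_ifs <;> first | rfl | omega

theorem block_mul_truncation {j m : ℕ} (h : j < m) (i : ℕ) (g : Module.End K V) :
    block i j g * truncation m = block i j g :=
  end_ext fun k z => by simp [coord_block, coord_truncation, h]

theorem block_mul_truncation_of_le {j m : ℕ} (h : m ≤ j) (i : ℕ) (g : Module.End K V) :
    block i j g * truncation m = 0 :=
  end_ext fun k z => by simp [coord_block, coord_truncation, not_lt.2 h]

theorem truncation_mul_block_of_le {i m : ℕ} (h : m ≤ i) (j : ℕ) (g : Module.End K V) :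
    truncation m * block i j g = 0 :=
  end_ext fun k z => by
    simp only [Module.End.mul_apply, coord_truncation, coord_block]
    split_ifs <;> first | omega | simp

variable (K V) in
/-- The operators on `FreeSum V` given by matrices with finitely many nonzero entries, all of finite
rank. -/
noncomputable def blockFiniteRank : AddSubgroup (Module.End K (FreeSum V)) :=
  AddSubgroup.closure {h | ∃ i j, ∃ g ∈ finiteRank K V, h = block i j g}

theorem block_mem (i j : ℕ) {g : Module.End K V} (hg : g ∈ finiteRank K V) :
    block i j g ∈ blockFiniteRank K V :=
  AddSubgroup.subset_closure ⟨i, j, g, hg, rfl⟩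

theorem diagonal_mul_mem (g : Module.End K V) {h : Module.End K (FreeSum V)}
    (hh : h ∈ blockFiniteRank K V) : diagonal g * h ∈ blockFiniteRank K V := by
  induction hh using AddSubgroup.closure_induction with
  | mem x hx =>
    obtain ⟨i, j, g', hg', rfl⟩ := hx
    rw [diagonal_mul_block]
    exact block_mem _ _ (mul_mem_finiteRank g hg')
  | zero => simp
  | add x y _ _ hx hy => rw [mul_add]; exact add_mem hx hy
  | neg x _ hx => rw [mul_neg]; exact neg_mem hx

theorem mul_diagonal_mem (g : Module.End K V) {h : Module.End K (FreeSum V)}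
    (hh : h ∈ blockFiniteRank K V) : h * diagonal g ∈ blockFiniteRank K V := by
  induction hh using AddSubgroup.closure_induction with
  | mem x hx =>
    obtain ⟨i, j, g', hg', rfl⟩ := hx
    rw [block_mul_diagonal]
    exact block_mem _ _ (finiteRank_mul_mem g hg')
  | zero => simp
  | add x y _ _ hx hy => rw [add_mul]; exact add_mem hx hy
  | neg x _ hx => rw [neg_mul]; exact neg_mem hx

/-- A finite-rank idempotent acting on finitely many coordinates. -/
theorem exists_truncation_fix {s : Module.End K V} (hs : s ∈ finiteRank K V)
    {h : Module.End K (FreeSum V)} (hh : h ∈ blockFiniteRank K V) :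
    ∃ p ∈ finiteRank K V, p * p = p ∧ p * s = s ∧ s * p = s ∧ ∃ m,
      diagonal p * truncation m * h = h ∧ h * (diagonal p * truncation m) = h := by
  obtain ⟨p₀, hp₀, hpp₀, -, -, h1, h2⟩ := exists_idempotent_fix hs 0 (zero_mem _) (by simp)
  obtain ⟨_, ⟨p, hp, hpp, hps, hsp, m, rfl⟩, -, -, h3, h4⟩ := exists_localUnit_of_closure
    (E := {q | ∃ p ∈ finiteRank K V, p * p = p ∧ p * s = s ∧ s * p = s ∧ ∃ m,
      q = diagonal p * truncation m}) (by
      rintro _ ⟨p, hp, hpp, hps, hsp, m, rfl⟩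
      rw [mul_assoc, ← mul_assoc (truncation m), ← diagonal_mul_truncation, mul_assoc,
        (truncation_mul_truncation le_rfl).1, ← mul_assoc, ← map_mul, hpp]) (by
      rintro _ ⟨p, hp, hpp, hps, hsp, m, rfl⟩ _ ⟨i, j, g, hg, rfl⟩
      obtain ⟨p', hp', k1, k2, k3, k4, k5⟩ := exists_idempotent_fix hg p hp hpp
      have hm : m ≤ m + i + j + 1 := by omega
      refine ⟨_, ⟨p', hp', k1, ?_, ?_, m + i + j + 1, rfl⟩, ?_, ?_, ?_, ?_⟩
      · rw [← hps, ← mul_assoc, k2]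
      · rw [← hsp, mul_assoc, k3]
      · rw [mul_assoc, ← mul_assoc (truncation _), ← diagonal_mul_truncation, mul_assoc,
          (truncation_mul_truncation hm).2, ← mul_assoc, ← map_mul, k2]
      · rw [mul_assoc, ← mul_assoc (truncation _), ← diagonal_mul_truncation, mul_assoc,
          (truncation_mul_truncation hm).1, ← mul_assoc, ← map_mul, k3]
      · rw [mul_assoc, truncation_mul_block (by omega), diagonal_mul_block, k4]
      · rw [diagonal_mul_truncation, ← mul_assoc, block_mul_truncation (by omega),
          block_mul_diagonal, k5]) hh (diagonal p₀ * truncation 0)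
    ⟨p₀, hp₀, hpp₀, h1, h2, 0, rfl⟩
  exact ⟨p, hp, hpp, hps, hsp, m, h3, h4⟩

theorem truncation_corner_mem {p : Module.End K V} (hp : p ∈ finiteRank K V) (m : ℕ)
    (x : Module.End K (FreeSum V)) :
    (diagonal p * truncation m) * x * (diagonal p * truncation m) ∈ blockFiniteRank K V := by
  have : diagonal p * truncation m = ∑ i ∈ Finset.range m, block i i p := by
    simp [truncation, Finset.mul_sum, diagonal_mul_block]
  rw [this, Finset.sum_mul, Finset.sum_mul]
  refine sum_mem fun i _ => ?_
  rw [Finset.mul_sum]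
  refine sum_mem fun j _ => ?_
  have : block i i p * x * block j j p =
      block i j (p * (coord K i ∘ₗ x ∘ₗ single K j) * p) := rfl
  rw [this]
  exact block_mem _ _ (mul_mem_finiteRank _ hp)

theorem blockFiniteRank_mul_mem {h h' : Module.End K (FreeSum V)} (hh : h ∈ blockFiniteRank K V)
    (hh' : h' ∈ blockFiniteRank K V) : h * h' ∈ blockFiniteRank K V := by
  induction hh using AddSubgroup.closure_induction with
  | mem x hx =>
    obtain ⟨i, j, g, hg, rfl⟩ := hx
    induction hh' using AddSubgroup.closure_induction with
    | mem y hy =>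
      obtain ⟨k, l, g', hg', rfl⟩ := hy
      by_cases hjk : j = k
      · subst hjk
        rw [block_mul_block]
        exact block_mem _ _ (mul_mem_finiteRank g hg')
      · rw [block_mul_block_of_ne hjk]
        exact zero_mem _
    | zero => simp
    | add x y _ _ hx hy => rw [mul_add]; exact add_mem hx hy
    | neg x _ hx => rw [mul_neg]; exact neg_mem hx
  | zero => simp
  | add x y _ _ hx hy => rw [add_mul]; exact add_mem hx hy
  | neg x _ hx => rw [neg_mul]; exact neg_mem hx

theorem blockFiniteRank_le : blockFiniteRank K V ≤ finiteRank K (FreeSum V) := by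
  rw [blockFiniteRank, AddSubgroup.closure_le]
  rintro _ ⟨i, j, g, hg, rfl⟩
  change block i j g ∈ finiteRank K (FreeSum V)
  induction hg using AddSubgroup.closure_induction with
  | mem x hx =>
    obtain ⟨v, w, rfl⟩ := hx
    have : block i j (rankOne v w) = rankOne (single K i v) (w ∘ₗ coord K j) := by
      refine LinearMap.ext fun z => ?_; simp [block_apply]
    rw [this]
    exact rankOne_mem _ _
  | zero => simp
  | add x y _ _ hx hy => rw [block_add]; exact add_mem hx hy
  | neg x _ hx => rw [block_neg]; exact neg_mem hx

theorem exists_forall_block_mul_eq_zero {h : Module.End K (FreeSum V)}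
    (hh : h ∈ blockFiniteRank K V) :
    ∃ m, ∀ k ≥ m, ∀ i g, block i k g * h = 0 ∧ h * block k i g = 0 := by
  obtain ⟨p, -, -, -, -, m, h1, h2⟩ := exists_truncation_fix (zero_mem (finiteRank K V)) hh
  refine ⟨m, fun k hk i g => ⟨?_, ?_⟩⟩
  · rw [← h1, diagonal_mul_truncation, ← mul_assoc, ← mul_assoc, block_mul_truncation_of_le hk,
      zero_mul, zero_mul]
  · rw [← h2, mul_assoc, mul_assoc, truncation_mul_block_of_le hk, mul_zero, mul_zero]

theorem eq_zero_of_diagonal_mem {g : Module.End K V} (hg : diagonal g ∈ blockFiniteRank K V) :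
    g = 0 := by
  obtain ⟨m, hm⟩ := exists_forall_block_mul_eq_zero hg
  have := (hm m le_rfl m 1).1
  rw [block_mul_diagonal, one_mul, ← block_zero m m] at this
  exact block_injective m m this

end Blocks

open FreeSum

section ChainRing

variable (K V : Type) [Field K] [AddCommGroup V] [Module K V]

/-- The triples consisting of a scalar, an operator on `V` and an operator on `FreeSum V`, each
extending the previous one up to operators of finite rank. -/
noncomputable def chainRing : Subalgebra K (K × Module.End K V × Module.End K (FreeSum V)) where
  carrier := {x | x.2.1 - algebraMap K _ x.1 ∈ finiteRank K V ∧
    x.2.2 - diagonal x.2.1 ∈ blockFiniteRank K V}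
  mul_mem' := by
    rintro ⟨c, g, y⟩ ⟨c', g', y'⟩ ⟨h1, h2⟩ ⟨h1', h2'⟩
    dsimp only at h1 h2 h1' h2'
    constructor
    · change g * g' - algebraMap K _ (c * c') ∈ _
      have : g * g' - algebraMap K _ (c * c') = (g - algebraMap K _ c) * g' +
          algebraMap K _ c * (g' - algebraMap K _ c') := by rw [map_mul]; noncomm_ring
      rw [this]
      exact add_mem (finiteRank_mul_mem _ h1) (mul_mem_finiteRank _ h1')
    · change y * y' - diagonal (g * g') ∈ _
      have : y * y' - diagonal (g * g') = (y - diagonal g) * diagonal g' +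
          (y - diagonal g) * (y' - diagonal g') + diagonal g * (y' - diagonal g') := by
        rw [map_mul]; noncomm_ring
      rw [this]
      exact add_mem (add_mem (mul_diagonal_mem _ h2) (blockFiniteRank_mul_mem h2 h2'))
        (diagonal_mul_mem _ h2')
  add_mem' := by
    rintro ⟨c, g, y⟩ ⟨c', g', y'⟩ ⟨h1, h2⟩ ⟨h1', h2'⟩
    constructor
    · change g + g' - algebraMap K _ (c + c') ∈ _
      rw [map_add, add_sub_add_comm]
      exact add_mem h1 h1'
    · change y + y' - diagonal (g + g') ∈ _
      rw [map_add, add_sub_add_comm]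
      exact add_mem h2 h2'
  algebraMap_mem' c := by
    constructor
    · change algebraMap K _ c - algebraMap K _ c ∈ _
      rw [sub_self]
      exact zero_mem _
    · change algebraMap K _ c - diagonal (algebraMap K _ c) ∈ _
      have : algebraMap K _ c = diagonal (K := K) (V := V) (algebraMap K _ c) :=
        end_ext (K := K) fun k z => by
        simp [coord_diagonal]
      rw [← this, sub_self]
      exact zero_mem _

variable {K V}

theorem exists_unit_chainRing (a : chainRing K V) : ∃ u : (chainRing K V)ˣ, a = a * u * a := by
  obtain ⟨⟨c, g, y⟩, hs, hh⟩ := a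
  dsimp only at hs hh
  obtain ⟨p, hp, hpp, hps, hsp, m, hqh, hhq⟩ := exists_truncation_fix hs hh
  set q := diagonal p * truncation m with hq
  obtain ⟨c', hc', hcc⟩ : ∃ c' : K, c' ≠ 0 ∧ c * c' * c = c := by
    by_cases hc : c = 0
    · exact ⟨1, one_ne_zero, by simp [hc]⟩
    · exact ⟨c⁻¹, inv_ne_zero hc, by field_simp⟩
  set z : Module.End K V := algebraMap K _ c with hz
  set t : Module.End K V := algebraMap K _ c' with ht
  set t' : Module.End K V := algebraMap K _ c'⁻¹ with ht'
  have htt' : t * t' = 1 := by rw [ht, ht', ← map_mul, mul_inv_cancel₀ hc', map_one]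
  have ht't : t' * t = 1 := by rw [ht, ht', ← map_mul, inv_mul_cancel₀ hc', map_one]
  have hzp : p * z = z * p := (Algebra.commutes _ _).symm
  have htp : p * t = t * p := (Algebra.commutes _ _).symm
  have ht'p : p * t' = t' * p := (Algebra.commutes _ _).symm
  have hztz : z * t * z = z := by rw [hz, ht, ← map_mul, ← map_mul, hcc]
  have hgp : g * p = z * p + (g - z) := by rw [← hsp, sub_mul]; abel
  have hpg : p * g = g * p := by rw [hgp, ← hzp, ← hps, mul_sub]; abel
  have hg : g * (1 - p) = z * (1 - p) := by rw [mul_sub, hgp]; noncomm_ring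
  have hgp' : p * (1 - p) = 0 := by rw [mul_sub, hpp]; simp
  obtain ⟨u, u', hpu, hup, hpu', hup', huu', hu'u, hgug⟩ :=
    exists_unit_inner_inverse_corner (y := g * p) hp hpp (by rw [← mul_assoc, hpg, mul_assoc, hpp])
      (by rw [mul_assoc, hpp])
  have hzc : ∀ x, z * x = x * z := Algebra.commutes _
  have htc : ∀ x, t * x = x * t := Algebra.commutes _
  obtain ⟨hT, hT', hgTg⟩ := exists_unit_of_corner (x := g) hpp htp ht'p htt' ht't (by
    have hc : t * (z * (1 - p)) = (1 - p) * z * t := by rw [hzc, htc]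
    rw [mul_assoc _ g, hg, mul_assoc, hc, ← mul_assoc, ← mul_assoc, hg, mul_assoc, mul_assoc,
      ← mul_assoc _ z, ← hc, ← mul_assoc, ← mul_assoc, hztz])
    hpg hpu hup hpu' hup' huu' hu'u (by
    conv_rhs => rw [← hgug]
    rw [mul_assoc g p u, hpu, ← hpg, ← mul_assoc, mul_assoc g u p, hup])
  set T := t * (1 - p) + u with hTdef
  set T' := t' * (1 - p) + u' with hT'def
  have hpT : p * T = T * p := by
    rw [hTdef, mul_add, add_mul, hpu, hup, ← mul_assoc, htp, mul_assoc, mul_assoc, sub_mul, mul_sub]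
    simp
  have hpT' : p * T' = T' * p := by
    rw [hT'def, mul_add, add_mul, hpu', hup', ← mul_assoc, ht'p, mul_assoc, mul_assoc, sub_mul,
      mul_sub]
    simp
  have hqc : ∀ k, p * k = k * p → q * diagonal k = diagonal k * q := by
    intro k hk
    rw [hq, mul_assoc, ← diagonal_mul_truncation, ← mul_assoc, ← map_mul, hk, map_mul, mul_assoc]
  have hqq : q * q = q := by
    rw [hq, mul_assoc, ← mul_assoc (truncation m), ← diagonal_mul_truncation, mul_assoc,
      (truncation_mul_truncation le_rfl).1, ← mul_assoc, ← map_mul, hpp]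
  have hqS : ∀ x, q * x * q ∈ blockFiniteRank K V := truncation_corner_mem hp m
  have hqm : q ∈ blockFiniteRank K V := by simpa [hqq] using hqS 1
  have hyq : y * q = diagonal g * q + (y - diagonal g) := by rw [← hhq, sub_mul]; abel
  have hqy : q * y = y * q := by rw [hyq, ← hqc g hpg, ← hqh, mul_sub]; abel
  have hy : y * (1 - q) = diagonal g * (1 - q) := by rw [mul_sub, hyq]; noncomm_ring
  obtain ⟨w, w', hqw, hwq, hqw', hwq', hww', hw'w, hywy⟩ :=
    exists_unit_inner_inverse_corner (y := y * q) (blockFiniteRank_le hqm) hqq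
      (by rw [← mul_assoc, hqy, mul_assoc, hqq]) (by rw [mul_assoc, hqq])
  obtain ⟨hW, hW', hyWy⟩ := exists_unit_of_corner (x := y) hqq (hqc T hpT) (hqc T' hpT')
    (by rw [← map_mul, hT, map_one]) (by rw [← map_mul, hT', map_one]) (by
      have hTg : p * (T * g) = T * g * p := by rw [← mul_assoc, hpT, mul_assoc, hpg, mul_assoc]
      rw [mul_assoc _ y, hy, mul_assoc, ← mul_assoc (diagonal T), ← map_mul, mul_sub, mul_one,
        ← hqc _ hTg, show diagonal (T * g) - q * diagonal (T * g) = (1 - q) * diagonal (T * g) by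
        noncomm_ring, ← mul_assoc, hy, mul_assoc, sub_mul, hqc _ hTg, one_mul,
        ← mul_one_sub, ← mul_assoc, ← map_mul, ← mul_assoc, hgTg])
    hqy hqw hwq hqw' hwq' hww' hw'w (by
    conv_rhs => rw [← hywy]
    rw [mul_assoc y q w, hqw, ← hqy, ← mul_assoc, mul_assoc y w q, hwq])
  have mem : ∀ (d : K) (a b : Module.End K V) (k : Module.End K (FreeSum V)),
      a = algebraMap K _ d → p * b = b → q * k * q = k →
      (d, a * (1 - p) + b, diagonal (a * (1 - p) + b) * (1 - q) + k) ∈ chainRing K V := by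
    rintro d _ b k rfl hb hk
    constructor
    · change algebraMap K _ d * (1 - p) + b - algebraMap K _ d ∈ _
      rw [show algebraMap K _ d * (1 - p) + b - algebraMap K _ d = b - algebraMap K _ d * p by
        noncomm_ring, ← hb]
      exact sub_mem (finiteRank_mul_mem _ hp) (mul_mem_finiteRank _ hp)
    · change diagonal (_ * (1 - p) + b) * (1 - q) + k - diagonal _ ∈ _
      have : ∀ D : Module.End K (FreeSum V), D * (1 - q) + k - D = k - D * q := fun D => by
        noncomm_ring
      rw [this]
      exact sub_mem (hk ▸ hqS k) (diagonal_mul_mem _ hqm)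
  refine ⟨⟨⟨_, mem c' t u w rfl hpu (by rw [hqw, hwq])⟩, ⟨_, mem c'⁻¹ t' u' w' rfl hpu'
    (by rw [hqw', hwq'])⟩, ?_, ?_⟩, ?_⟩
  · exact Subtype.ext (Prod.ext (mul_inv_cancel₀ hc') (Prod.ext hT hW))
  · exact Subtype.ext (Prod.ext (inv_mul_cancel₀ hc') (Prod.ext hT' hW'))
  · exact Subtype.ext (Prod.ext hcc.symm (Prod.ext hgTg.symm hyWy.symm))

namespace chainRing

variable (K V) in
/-- The scalar component. -/
noncomputable def scalar : chainRing K V →ₐ[K] K := (AlgHom.fst K _ _).comp (chainRing K V).val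

variable (K V) in
/-- The component acting on `V`. -/
noncomputable def onBase : chainRing K V →ₐ[K] Module.End K V :=
  (AlgHom.fst K _ _).comp ((AlgHom.snd K K _).comp (chainRing K V).val)

variable (K V) in
/-- The component acting on `FreeSum V`. -/
noncomputable def onSum : chainRing K V →ₐ[K] Module.End K (FreeSum V) :=
  (AlgHom.snd K _ _).comp ((AlgHom.snd K K _).comp (chainRing K V).val)

/-- The element given by a finite block matrix. -/
noncomputable def ofBlock (h : Module.End K (FreeSum V)) (hh : h ∈ blockFiniteRank K V) :
    chainRing K V :=
  ⟨(0, 0, h), by simp [zero_mem], by simpa using hh⟩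

/-- The element acting diagonally by an operator of finite rank. -/
noncomputable def ofFiniteRank (g : Module.End K V) (hg : g ∈ finiteRank K V) : chainRing K V :=
  ⟨(0, g, diagonal g), by simpa using hg, by simp [zero_mem]⟩

section

variable (h : Module.End K (FreeSum V)) (hh : h ∈ blockFiniteRank K V)
  (g : Module.End K V) (hg : g ∈ finiteRank K V)

@[simp] theorem scalar_ofBlock : scalar K V (ofBlock h hh) = 0 := rfl
@[simp] theorem onBase_ofBlock : onBase K V (ofBlock h hh) = 0 := rfl
@[simp] theorem onSum_ofBlock : onSum K V (ofBlock h hh) = h := rfl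
@[simp] theorem scalar_ofFiniteRank : scalar K V (ofFiniteRank g hg) = 0 := rfl
@[simp] theorem onBase_ofFiniteRank : onBase K V (ofFiniteRank g hg) = g := rfl
@[simp] theorem onSum_ofFiniteRank : onSum K V (ofFiniteRank g hg) = diagonal g := rfl

end

theorem onBase_sub_mem (x : chainRing K V) :
    onBase K V x - algebraMap K _ (scalar K V x) ∈ finiteRank K V := x.2.1

theorem onSum_sub_mem (x : chainRing K V) :
    onSum K V x - diagonal (onBase K V x) ∈ blockFiniteRank K V := x.2.2

theorem onSum_mem {x : chainRing K V} (hx : onBase K V x = 0) :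
    onSum K V x ∈ blockFiniteRank K V := by
  simpa [hx] using onSum_sub_mem x

theorem onBase_mem {x : chainRing K V} (hx : scalar K V x = 0) : onBase K V x ∈ finiteRank K V := by
  simpa [hx] using onBase_sub_mem x

theorem scalar_eq_zero (hV : ¬ Module.Finite K V) {x : chainRing K V} (hx : onBase K V x = 0) :
    scalar K V x = 0 := by
  by_contra hc
  have h := onBase_sub_mem x
  rw [hx, zero_sub, neg_mem_iff] at h
  refine one_notMem_finiteRank hV ?_
  have := mul_mem_finiteRank (algebraMap K _ (scalar K V x)⁻¹) h
  rwa [← map_mul, inv_mul_cancel₀ hc, map_one] at this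

theorem onSum_injective (hV : ¬ Module.Finite K V) : Function.Injective (onSum K V) := by
  rw [injective_iff_map_eq_zero]
  intro x hx
  have h1 : onBase K V x = 0 := by
    apply eq_zero_of_diagonal_mem
    have := onSum_sub_mem x
    rwa [hx, zero_sub, neg_mem_iff] at this
  exact Subtype.ext (Prod.ext (scalar_eq_zero hV h1) (Prod.ext h1 hx))

variable {v₀ : V} {w₀ : Module.Dual K V}

/-- The idempotent generating the operators of finite rank. -/
noncomputable def baseIdem (v₀ : V) (w₀ : Module.Dual K V) : chainRing K V :=
  ofFiniteRank (rankOne v₀ w₀) (rankOne_mem _ _)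

/-- The idempotent generating the finite block matrices. -/
noncomputable def blockIdem (v₀ : V) (w₀ : Module.Dual K V) : chainRing K V :=
  ofBlock (block 0 0 (rankOne v₀ w₀)) (block_mem _ _ (rankOne_mem _ _))

@[simp]
theorem onSum_baseIdem : onSum K V (baseIdem v₀ w₀) = diagonal (rankOne v₀ w₀) := rfl

@[simp]
theorem onBase_baseIdem : onBase K V (baseIdem v₀ w₀) = rankOne v₀ w₀ := rfl

@[simp]
theorem scalar_baseIdem : scalar K V (baseIdem v₀ w₀) = 0 := rfl

@[simp]
theorem onSum_blockIdem : onSum K V (blockIdem v₀ w₀) = block 0 0 (rankOne v₀ w₀) := rfl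

@[simp]
theorem onBase_blockIdem : onBase K V (blockIdem v₀ w₀) = 0 := rfl

theorem rankOne_mul_mul_rankOne (v v' : V) (w w' : Module.Dual K V) (g : Module.End K V) :
    rankOne v w * g * rankOne v' w' = w (g v') • rankOne v w' := by
  rw [mul_assoc, mul_rankOne, rankOne_mul_rankOne]

section Idempotents

variable (hV : ¬ Module.Finite K V) (h : w₀ v₀ = 1)

include h

theorem rankOne_idem : rankOne v₀ w₀ * rankOne v₀ w₀ = rankOne v₀ w₀ := by
  rw [rankOne_mul_rankOne, h, one_smul]

theorem rankOne_ne_zero : rankOne v₀ w₀ ≠ 0 := by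
  intro h0
  have := congrArg w₀ (LinearMap.congr_fun h0 v₀)
  simp [h] at this

omit h in
theorem onBase_baseIdem_mul (x : chainRing K V) :
    onBase K V (baseIdem v₀ w₀ * x * baseIdem v₀ w₀) =
      w₀ (onBase K V x v₀) • rankOne v₀ w₀ := by
  simp [rankOne_mul_mul_rankOne]

include hV

theorem baseIdem_idem : baseIdem v₀ w₀ * baseIdem v₀ w₀ = baseIdem v₀ w₀ :=
  onSum_injective hV (by rw [map_mul, onSum_baseIdem, ← map_mul, rankOne_idem h])

theorem blockIdem_idem : blockIdem v₀ w₀ * blockIdem v₀ w₀ = blockIdem v₀ w₀ :=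
  onSum_injective hV (by simp [block_mul_block, rankOne_idem h])

theorem baseIdem_mul_blockIdem : baseIdem v₀ w₀ * blockIdem v₀ w₀ = blockIdem v₀ w₀ :=
  onSum_injective hV (by simp [diagonal_mul_block, rankOne_idem h])

theorem blockIdem_mul_baseIdem : blockIdem v₀ w₀ * baseIdem v₀ w₀ = blockIdem v₀ w₀ :=
  onSum_injective hV (by simp [block_mul_diagonal, rankOne_idem h])

omit hV in
theorem blockIdem_ne_zero : blockIdem v₀ w₀ ≠ 0 := by
  intro h0
  have := congrArg (onSum K V) h0
  rw [onSum_blockIdem, map_zero, ← block_zero 0 0] at this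
  exact rankOne_ne_zero h (block_injective 0 0 this)

omit h in
theorem blockIdem_mul_mul (x : chainRing K V) :
    ∃ c : K, blockIdem v₀ w₀ * x * blockIdem v₀ w₀ = c • blockIdem v₀ w₀ := by
  refine ⟨w₀ (coord K 0 (onSum K V x (single K 0 v₀))), onSum_injective hV ?_⟩
  rw [map_smul, map_mul, map_mul, onSum_blockIdem, ← block_smul]
  exact congrArg (block 0 0) (rankOne_mul_mul_rankOne v₀ v₀ w₀ w₀
    (coord K 0 ∘ₗ onSum K V x ∘ₗ single K 0))

theorem exists_blockIdem_mul_ne_zero {x : chainRing K V} (hx : x ≠ 0) :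
    ∃ r s, blockIdem v₀ w₀ * r * x * s * blockIdem v₀ w₀ ≠ 0 := by
  have hx : onSum K V x ≠ 0 := fun h0 => hx (onSum_injective hV (by rw [h0, map_zero]))
  obtain ⟨j, k, v, hv⟩ : ∃ j k v, coord K k (onSum K V x (single K j v)) ≠ 0 := by
    by_contra! hc
    exact hx (Finsupp.lhom_ext fun j v => Finsupp.ext fun k => hc j k v)
  obtain ⟨w, hw⟩ := Module.Projective.exists_dual_eq_one K hv
  refine ⟨ofBlock (block 0 k (rankOne v₀ w)) (block_mem _ _ (rankOne_mem _ _)),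
    ofBlock (block j 0 (rankOne v w₀)) (block_mem _ _ (rankOne_mem _ _)), fun h0 => ?_⟩
  have := congrArg (fun y => w₀ (coord K 0 (onSum K V y (single K 0 v₀)))) h0
  simp [block_apply, coord_single, h, hw] at this

omit hV in
theorem exists_baseIdem_mul_ne_zero {x : chainRing K V} (hx : onBase K V x ≠ 0) :
    ∃ r s, onBase K V (baseIdem v₀ w₀ * r * x * s * baseIdem v₀ w₀) ≠ 0 := by
  obtain ⟨v, hv⟩ : ∃ v, onBase K V x v ≠ 0 := by
    by_contra! hc
    exact hx (LinearMap.ext hc)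
  obtain ⟨w, hw⟩ := Module.Projective.exists_dual_eq_one K hv
  refine ⟨ofFiniteRank (rankOne v₀ w) (rankOne_mem _ _),
    ofFiniteRank (rankOne v w₀) (rankOne_mem _ _), fun h0 => ?_⟩
  have := congrArg w₀ (LinearMap.congr_fun h0 v₀)
  simp [h, hw] at this

theorem mem_sandwich_blockIdem {x : chainRing K V} (hx : onBase K V x = 0) :
    x ∈ sandwich (blockIdem v₀ w₀) := by
  have key : blockFiniteRank K V ≤
      (sandwich (blockIdem v₀ w₀)).map (onSum K V : chainRing K V →+ Module.End K (FreeSum V)) := by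
    rw [blockFiniteRank, AddSubgroup.closure_le]
    rintro _ ⟨i, j, g, hg, rfl⟩
    change block i j g ∈ AddSubgroup.map _ _
    induction hg using AddSubgroup.closure_induction with
    | mem x hx =>
      obtain ⟨v, w, rfl⟩ := hx
      refine ⟨_, AddSubgroup.subset_closure
        ⟨ofBlock (block i 0 (rankOne v w₀)) (block_mem _ _ (rankOne_mem _ _)),
          ofBlock (block 0 j (rankOne v₀ w)) (block_mem _ _ (rankOne_mem _ _)), rfl⟩, ?_⟩
      simp [block_mul_block, rankOne_mul_rankOne, h]
    | zero => rw [block_zero]; exact zero_mem _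
    | add x y _ _ hx hy => rw [block_add]; exact add_mem hx hy
    | neg x _ hx => rw [block_neg]; exact neg_mem hx
  obtain ⟨y, hy, hyx⟩ := key (onSum_mem hx)
  rwa [← onSum_injective hV hyx]

theorem mem_sandwich_baseIdem {x : chainRing K V} (hx : scalar K V x = 0) :
    x ∈ sandwich (baseIdem v₀ w₀) := by
  have key : finiteRank K V ≤
      (sandwich (baseIdem v₀ w₀)).map (onBase K V : chainRing K V →+ Module.End K V) := by
    rw [finiteRank, AddSubgroup.closure_le]
    rintro _ ⟨v, w, rfl⟩
    refine ⟨_, AddSubgroup.subset_closure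
      ⟨ofFiniteRank (rankOne v w₀) (rankOne_mem _ _),
        ofFiniteRank (rankOne v₀ w) (rankOne_mem _ _), rfl⟩, ?_⟩
    simp [rankOne_mul_rankOne, h]
  obtain ⟨y, hy, hyx⟩ := key (onBase_mem hx)
  have hxy : x - y ∈ sandwich (blockIdem v₀ w₀) := mem_sandwich_blockIdem hV h (by
    rw [map_sub, sub_eq_zero]
    exact hyx.symm)
  have hle : sandwich (blockIdem v₀ w₀) ≤ sandwich (baseIdem v₀ w₀) := by
    rw [sandwich, AddSubgroup.closure_le]
    rintro _ ⟨r, s, rfl⟩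
    refine AddSubgroup.subset_closure ⟨r, blockIdem v₀ w₀ * s, ?_⟩
    rw [mul_assoc r (baseIdem v₀ w₀), ← mul_assoc (baseIdem v₀ w₀), baseIdem_mul_blockIdem hV h,
      mul_assoc]
  simpa using add_mem (hle hxy) hy

theorem idempotent_below_baseIdem {g : chainRing K V} (hg : g * g = g) (h1 : baseIdem v₀ w₀ * g = g)
    (h2 : g * baseIdem v₀ w₀ = g) :
    g ∈ sandwich (blockIdem v₀ w₀) ∨ baseIdem v₀ w₀ - g ∈ sandwich (blockIdem v₀ w₀) := by
  have hc := onBase_baseIdem_mul (v₀ := v₀) (w₀ := w₀) g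
  rw [h1, h2] at hc
  set c := w₀ (onBase K V g v₀)
  have hcc : c * c = c := by
    have := congrArg (onBase K V) hg
    rw [map_mul, hc, smul_mul_smul_comm, rankOne_idem h, ← sub_eq_zero, ← sub_smul,
      smul_eq_zero] at this
    exact sub_eq_zero.1 (this.resolve_right (rankOne_ne_zero h))
  rcases IsIdempotentElem.iff_eq_zero_or_one.1 (show IsIdempotentElem c from hcc) with h0 | h0
  · exact .inl (mem_sandwich_blockIdem hV h (by rw [hc, h0, zero_smul]))
  · exact .inr (mem_sandwich_blockIdem hV h (by
      rw [map_sub, hc, h0, one_smul, onBase_baseIdem, sub_self]))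

theorem idempotent_mem_sandwich {g : chainRing K V} (hg : g * g = g) :
    g ∈ sandwich (baseIdem v₀ w₀) ∨ 1 - g ∈ sandwich (baseIdem v₀ w₀) := by
  have hcc : scalar K V g * scalar K V g = scalar K V g := by rw [← map_mul, hg]
  rcases IsIdempotentElem.iff_eq_zero_or_one.1 (show IsIdempotentElem (scalar K V g) from hcc)
    with h0 | h0
  · exact .inl (mem_sandwich_baseIdem hV h h0)
  · exact .inr (mem_sandwich_baseIdem hV h (by rw [map_sub, h0, map_one, sub_self]))

end Idempotents

end chainRing

end ChainRing

theorem op_mem_sandwich {R : Type} [Ring R] {e x : R} (hx : x ∈ sandwich e) :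
    op x ∈ sandwich (op e) := by
  induction hx using AddSubgroup.closure_induction with
  | mem x hx =>
    obtain ⟨r, s, rfl⟩ := hx
    exact AddSubgroup.subset_closure ⟨op s, op r, by simp [mul_assoc]⟩
  | zero => exact zero_mem _
  | add x y _ _ hx hy => exact add_mem hx hy
  | neg x _ hx => exact neg_mem hx

theorem unop_mem_sandwich {R : Type} [Ring R] {e : R} {x : Rᵐᵒᵖ} (hx : unop x ∈ sandwich e) :
    x ∈ sandwich (op e) := op_mem_sandwich hx

theorem IsPrimitiveLevel.of_scalar {K B : Type} [Field K] [Ring B] [Algebra K B] {J : Ideal B}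
    {e : B} (h1 : ∀ x ∈ J, ∀ r, x * r ∈ J) (h2 : e * e = e) (h3 : e ∉ J)
    (h4 : ∀ x, ∃ c : K, e * x * e - c • e ∈ J) (h5 : ∀ x, x ∉ J → ∃ r s, e * r * x * s * e ∉ J) :
    IsPrimitiveLevel J e where
  mul_mem := h1
  idem := h2
  notMem := h3
  exists_mul := h5
  exists_inv x := by
    obtain ⟨c, hc⟩ := h4 x
    by_cases h0 : c = 0
    · exact .inl (by simpa [h0] using hc)
    · refine .inr ⟨c⁻¹ • 1, ?_⟩
      have := J.mul_mem_left (c⁻¹ • 1) hc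
      rw [mul_sub, smul_mul_assoc, one_mul, smul_mul_assoc, one_mul, smul_smul,
        inv_mul_cancel₀ h0, one_smul] at this
      simpa [h2] using this

/-- The left module over the corner ring of `e` generated by a family, as a `K`-subspace. -/
def cornerSpan (K : Type) {B ι : Type} [Field K] [Ring B] [Algebra K B] (e : B) (x : ι → B) :
    Submodule K B where
  __ := AddSubgroup.closure {z | ∃ r b, z = e * r * e * x b}
  smul_mem' c y hy := by
    change c • y ∈ AddSubgroup.closure {z | ∃ r b, z = e * r * e * x b}
    induction hy using AddSubgroup.closure_induction with
    | mem y hy =>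
      obtain ⟨r, b, rfl⟩ := hy
      exact AddSubgroup.subset_closure ⟨c • r, b, by simp⟩
    | zero => rw [smul_zero]; exact zero_mem _
    | add y z _ _ hy hz => rw [smul_add]; exact add_mem hy hz
    | neg y _ hy => rw [smul_neg]; exact neg_mem hy

theorem mul_mem_cornerSpan {K B ι : Type} [Field K] [Ring B] [Algebra K B] {e : B} {x : ι → B}
    (r : B) (b : ι) : e * r * e * x b ∈ cornerSpan K e x :=
  AddSubgroup.subset_closure ⟨r, b, rfl⟩

section

variable {K V N ι : Type} [Field K] [AddCommGroup V] [Module K V] [AddCommGroup N] [Module K N]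

theorem rankOne_mem_of_basis_dual (G : Module.End K V →ₗ[K] N) (D : Submodule K N) (v : V)
    (b : Module.Basis ι K (Module.Dual K V)) (hb : ∀ i, G (rankOne v (b i)) ∈ D)
    (w : Module.Dual K V) : G (rankOne v w) ∈ D := by
  have : Submodule.span K (Set.range b) ≤ D.comap (G ∘ₗ LinearMap.smulRightₗ.flip v) :=
    Submodule.span_le.2 (by rintro _ ⟨i, rfl⟩; exact hb i)
  exact this (b.mem_span w)

theorem rankOne_mem_of_basis (G : Module.End K V →ₗ[K] N) (D : Submodule K N)
    (w : Module.Dual K V) (b : Module.Basis ι K V) (hb : ∀ i, G (rankOne (b i) w) ∈ D) (v : V) :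
    G (rankOne v w) ∈ D := by
  have : Submodule.span K (Set.range b) ≤ D.comap (G ∘ₗ LinearMap.smulRightₗ w) :=
    Submodule.span_le.2 (by rintro _ ⟨i, rfl⟩; exact hb i)
  exact this (b.mem_span v)

variable (K V) in
/-- `block i j` as a linear map. -/
noncomputable def blockLinear (i j : ℕ) : Module.End K V →ₗ[K] Module.End K (FreeSum V) where
  toFun := block i j
  map_add' := block_add i j
  map_smul' := block_smul i j

variable (K V) in
/-- `diagonal` as a linear map. -/
noncomputable def diagonalLinear : Module.End K V →ₗ[K] Module.End K (FreeSum V) where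
  toFun := diagonal
  map_add' := map_add _
  map_smul' _ _ := end_ext fun _ _ => rfl

theorem diagonal_rankOne_single (v v' : V) (w : Module.Dual K V) (j : ℕ) :
    diagonal (rankOne v w) (single K j v') = w v' • single K j v := by
  refine Finsupp.ext fun k => ?_
  change coord K k (diagonal (rankOne v w) (single K j v')) = coord K k (w v' • single K j v)
  rw [map_smul, coord_diagonal, coord_single, coord_single]
  split_ifs <;> simp

end

namespace chainRing

variable {K V : Type} [Field K] [AddCommGroup V] [Module K V]

variable (K V) in
/-- The elements acting trivially on `V`. -/
noncomputable def baseIdeal : Ideal (chainRing K V)ᵐᵒᵖ :=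
  RingHom.ker (RingHom.op (onBase K V : chainRing K V →+* Module.End K V))

variable (K V) in
/-- The elements with trivial scalar component. -/
noncomputable def scalarIdeal : Ideal (chainRing K V)ᵐᵒᵖ :=
  RingHom.ker (RingHom.op (scalar K V : chainRing K V →+* K))

theorem mem_baseIdeal {x : (chainRing K V)ᵐᵒᵖ} : x ∈ baseIdeal K V ↔ onBase K V (unop x) = 0 := by
  simp [baseIdeal, RingHom.mem_ker]

theorem mem_scalarIdeal {x : (chainRing K V)ᵐᵒᵖ} :
    x ∈ scalarIdeal K V ↔ scalar K V (unop x) = 0 := by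
  simp [scalarIdeal, RingHom.mem_ker]

section

variable (hV : ¬ Module.Finite K V) {v₀ : V} {w₀ : Module.Dual K V} (h : w₀ v₀ = 1)

include hV h

theorem isPrimitiveLevel_bot : IsPrimitiveLevel (⊥ : Ideal (chainRing K V)ᵐᵒᵖ)
    (op (blockIdem v₀ w₀)) := by
  refine .of_scalar (K := K) (by simp) ?_ ?_ ?_ ?_
  · rw [← op_mul, blockIdem_idem hV h]
  · simpa using blockIdem_ne_zero h
  · intro x
    obtain ⟨c, hc⟩ := blockIdem_mul_mul hV (v₀ := v₀) (w₀ := w₀) (unop x)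
    refine ⟨c, ?_⟩
    rw [Ideal.mem_bot, sub_eq_zero]
    apply unop_injective
    simpa [mul_assoc] using hc
  · intro x hx
    obtain ⟨r, s, hrs⟩ := exists_blockIdem_mul_ne_zero hV h (x := unop x) (by simpa using hx)
    refine ⟨op s, op r, fun h0 => hrs ?_⟩
    simpa [mul_assoc] using congrArg unop (Ideal.mem_bot.1 h0)

theorem isPrimitiveLevel_baseIdeal : IsPrimitiveLevel (baseIdeal K V) (op (baseIdem v₀ w₀)) := by
  refine .of_scalar (K := K) ?_ ?_ ?_ ?_ ?_
  · intro x hx r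
    rw [mem_baseIdeal] at hx ⊢
    simp [hx]
  · rw [← op_mul, baseIdem_idem hV h]
  · rw [mem_baseIdeal]
    exact rankOne_ne_zero h
  · intro x
    refine ⟨w₀ (onBase K V (unop x) v₀), mem_baseIdeal.2 ?_⟩
    have := onBase_baseIdem_mul (v₀ := v₀) (w₀ := w₀) (unop x)
    simpa [sub_eq_zero, mul_assoc] using this
  · intro x hx
    rw [mem_baseIdeal] at hx
    obtain ⟨r, s, hrs⟩ := exists_baseIdem_mul_ne_zero h hx
    refine ⟨op s, op r, fun h0 => hrs ?_⟩
    simpa [mul_assoc] using mem_baseIdeal.1 h0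

omit hV h in
theorem isPrimitiveLevel_scalarIdeal : IsPrimitiveLevel (scalarIdeal K V) 1 := by
  refine .of_scalar (K := K) ?_ (one_mul 1) ?_ ?_ ?_
  · intro x hx r
    rw [mem_scalarIdeal] at hx ⊢
    simp [hx]
  · simp [mem_scalarIdeal]
  · intro x
    refine ⟨scalar K V (unop x), ?_⟩
    simp [mem_scalarIdeal]
  · intro x hx
    exact ⟨1, 1, by simpa using hx⟩

theorem mem_sandwich_of_mem_baseIdeal : ∀ x ∈ baseIdeal K V, x ∈ sandwich (op (blockIdem v₀ w₀)) :=
  fun _ hx => unop_mem_sandwich (mem_sandwich_blockIdem hV h (mem_baseIdeal.1 hx))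

theorem mem_sandwich_of_mem_scalarIdeal :
    ∀ x ∈ scalarIdeal K V, x ∈ sandwich (op (baseIdem v₀ w₀)) :=
  fun _ hx => unop_mem_sandwich (mem_sandwich_baseIdem hV h (mem_scalarIdeal.1 hx))

omit hV h in
theorem bot_lt_baseIdeal [Nontrivial V] : ⊥ < baseIdeal K V := by
  obtain ⟨v₀, hv⟩ := exists_ne (0 : V)
  obtain ⟨w₀, h⟩ := Module.Projective.exists_dual_eq_one K hv
  rw [bot_lt_iff_ne_bot, Submodule.ne_bot_iff]
  exact ⟨op (blockIdem v₀ w₀), mem_baseIdeal.2 rfl, by simpa using blockIdem_ne_zero h⟩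

omit h in
theorem baseIdeal_lt_scalarIdeal [Nontrivial V] : baseIdeal K V < scalarIdeal K V := by
  obtain ⟨v₀, hv⟩ := exists_ne (0 : V)
  obtain ⟨w₀, h⟩ := Module.Projective.exists_dual_eq_one K hv
  refine lt_of_le_of_ne (fun x hx => mem_scalarIdeal.2 (scalar_eq_zero hV (mem_baseIdeal.1 hx))) ?_
  intro heq
  refine (isPrimitiveLevel_baseIdeal hV h).notMem ?_
  rw [heq]
  exact mem_scalarIdeal.2 rfl

theorem exists_inv_blockIdem (x : chainRing K V) : blockIdem v₀ w₀ * x * blockIdem v₀ w₀ = 0 ∨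
    ∃ y, blockIdem v₀ w₀ * y * blockIdem v₀ w₀ * (blockIdem v₀ w₀ * x * blockIdem v₀ w₀) =
      blockIdem v₀ w₀ ∧ blockIdem v₀ w₀ * x * blockIdem v₀ w₀ *
      (blockIdem v₀ w₀ * y * blockIdem v₀ w₀) = blockIdem v₀ w₀ := by
  obtain ⟨c, hc⟩ := blockIdem_mul_mul hV (v₀ := v₀) (w₀ := w₀) x
  by_cases h0 : c = 0
  · exact .inl (by rw [hc, h0, zero_smul])
  · refine .inr ⟨c⁻¹ • 1, ?_⟩
    rw [hc]
    simp [blockIdem_idem hV h, smul_smul, h0]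

omit hV h in
theorem eq_zero_of_sum_mul_row {ι : Type} {b : ι → Module.Dual K V} (hb : LinearIndependent K b)
    {a : ι →₀ chainRing K V} (ha : ∀ i, a i * baseIdem v₀ w₀ = a i)
    (h0 : (a.sum fun i r => r * ofFiniteRank (rankOne v₀ (b i)) (rankOne_mem _ _)) = 0) (i : ι) :
    onSum K V (a i) = 0 := by
  have key : ∀ i j, onSum K V (a i) (single K j v₀) = 0 := by
    intro i j
    rw [← Module.forall_dual_apply_eq_zero_iff K]
    intro φ
    have hli := linearIndependent_iff'.1 hb a.support
      (fun i => φ (onSum K V (a i) (single K j v₀))) ?_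
    · by_cases hi : i ∈ a.support
      · exact hli i hi
      · rw [Finsupp.notMem_support_iff.1 hi]; simp
    · ext v
      have := congrArg (fun y => φ (onSum K V y (single K j v))) h0
      simp only [Finsupp.sum, map_sum, map_mul, onSum_ofFiniteRank, map_zero,
        LinearMap.sum_apply, Module.End.mul_apply, LinearMap.zero_apply] at this
      rw [LinearMap.sum_apply, LinearMap.zero_apply, ← this]
      refine Finset.sum_congr rfl fun i _ => ?_
      rw [diagonal_rankOne_single]
      simp [mul_comm]
  rw [← ha i, map_mul]
  refine Finsupp.lhom_ext fun j v => ?_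
  change onSum K V (a i) (diagonal (rankOne v₀ w₀) (single K j v)) = 0
  rw [diagonal_rankOne_single, map_smul, key, smul_zero]

theorem mem_cornerSpan_row {ι : Type} (b : Module.Basis ι K (Module.Dual K V)) {y : chainRing K V}
    (hy : baseIdem v₀ w₀ * y = y) : y ∈ cornerSpan K (baseIdem v₀ w₀)
      fun i => ofFiniteRank (rankOne v₀ (b i)) (rankOne_mem _ _) := by
  generalize hD : (cornerSpan K (baseIdem v₀ w₀) fun i =>
    ofFiniteRank (rankOne v₀ (b i)) (rankOne_mem _ _)).map (onSum K V).toLinearMap = D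
  have hblock : ∀ k j w, block k j (rankOne v₀ w) ∈ D := by
    intro k j
    refine rankOne_mem_of_basis_dual (blockLinear K V k j) D v₀ b fun i => ?_
    rw [← hD]
    refine ⟨_, mul_mem_cornerSpan (ofBlock (block k j (rankOne v₀ w₀))
      (block_mem _ _ (rankOne_mem _ _))) i, ?_⟩
    change onSum K V _ = block k j _
    simp [diagonal_mul_block, block_mul_diagonal, rankOne_mul_rankOne, h]
  have hdiagonal : ∀ w, diagonal (rankOne v₀ w) ∈ D := by
    refine rankOne_mem_of_basis_dual (diagonalLinear K V) D v₀ b fun i => ?_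
    rw [← hD]
    refine ⟨_, mul_mem_cornerSpan 1 i, ?_⟩
    change onSum K V _ = diagonal _
    rw [mul_one, baseIdem_idem hV h, map_mul, onSum_baseIdem, onSum_ofFiniteRank, ← map_mul,
      rankOne_mul_rankOne, h, one_smul]
  have hmul : ∀ g ∈ blockFiniteRank K V, diagonal (rankOne v₀ w₀) * g ∈ D := by
    intro g hg
    induction hg using AddSubgroup.closure_induction with
    | mem g hg =>
      obtain ⟨i, j, g, -, rfl⟩ := hg
      rw [diagonal_mul_block, rankOne_mul]
      exact hblock _ _ _
    | zero => rw [mul_zero]; exact zero_mem _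
    | add y z _ _ hy hz => rw [mul_add]; exact add_mem hy hz
    | neg y _ hy => rw [mul_neg]; exact neg_mem hy
  have hyD : onSum K V y ∈ D := by
    have : onSum K V y = diagonal (rankOne v₀ w₀) * (onSum K V y - diagonal (onBase K V y)) +
        diagonal (rankOne v₀ (w₀ ∘ₗ onBase K V y)) := by
      rw [← rankOne_mul, map_mul, mul_sub, sub_add_cancel, ← onSum_baseIdem, ← map_mul, hy]
    rw [this]
    exact add_mem (hmul _ (onSum_sub_mem y)) (hdiagonal _)
  rw [← hD] at hyD
  obtain ⟨z, hz, hzy⟩ := hyD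
  rwa [← onSum_injective hV hzy]

theorem left_hereditary (I : Ideal (chainRing K V)) : Module.Projective (chainRing K V) I := by
  refine hereditary_of_idempotents (e := baseIdem v₀ w₀) (f := blockIdem v₀ w₀)
    (baseIdem_idem hV h)
    (fun a => let ⟨u, hu⟩ := exists_unit_chainRing a; ⟨u, hu⟩)
    (blockIdem_idem hV h) (baseIdem_mul_blockIdem hV h) (blockIdem_mul_baseIdem hV h)
    (blockIdem_ne_zero h) (exists_inv_blockIdem hV h)
    (fun g => idempotent_below_baseIdem hV h) (fun g => idempotent_mem_sandwich hV h)
    (fun i => ofFiniteRank (rankOne v₀ (Module.Basis.ofVectorSpace K (Module.Dual K V) i))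
      (rankOne_mem _ _)) ?_ ?_ (fun y => mem_cornerSpan_row hV h _) I
  · intro i
    apply onSum_injective hV
    rw [map_mul, onSum_baseIdem, onSum_ofFiniteRank, ← map_mul, rankOne_mul_rankOne, h, one_smul]
  · intro a _ ha h0
    ext1 i
    apply onSum_injective hV
    rw [Finsupp.zero_apply, map_zero]
    exact eq_zero_of_sum_mul_row (Module.Basis.linearIndependent _) ha h0 i

omit hV h in
theorem eq_zero_of_sum_mul_column {ι : Type} {b : ι → V} (hb : LinearIndependent K b)
    {a : ι →₀ (chainRing K V)ᵐᵒᵖ} (ha : ∀ i, a i * op (baseIdem v₀ w₀) = a i)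
    (h0 : (a.sum fun i r => r * op (ofFiniteRank (rankOne (b i) w₀) (rankOne_mem _ _))) = 0)
    (i : ι) : onSum K V (unop (a i)) = 0 := by
  have key : ∀ k z, w₀ (coord K k (onSum K V (unop (a i)) z)) = 0 := by
    intro k z
    have hli := linearIndependent_iff'.1 hb a.support
      (fun i => w₀ (coord K k (onSum K V (unop (a i)) z))) ?_
    · by_cases hi : i ∈ a.support
      · exact hli i hi
      · rw [Finsupp.notMem_support_iff.1 hi]; simp
    · have := congrArg (fun y => coord K k (onSum K V (unop y) z)) h0
      simpa [Finsupp.sum, coord_diagonal] using this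
  rw [← ha i, unop_mul, map_mul]
  refine end_ext (K := K) fun k z => ?_
  simp [coord_diagonal, key]

theorem mem_cornerSpan_column {ι : Type} (b : Module.Basis ι K V) {y : (chainRing K V)ᵐᵒᵖ}
    (hy : op (baseIdem v₀ w₀) * y = y) : y ∈ cornerSpan K (op (baseIdem v₀ w₀))
      fun i => op (ofFiniteRank (rankOne (b i) w₀) (rankOne_mem _ _)) := by
  generalize hD : (cornerSpan K (op (baseIdem v₀ w₀)) fun i =>
    op (ofFiniteRank (rankOne (b i) w₀) (rankOne_mem _ _))).map
      ((onSum K V).toLinearMap ∘ₗ (opLinearEquiv K).symm.toLinearMap) = D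
  have hblock : ∀ k j v, block k j (rankOne v w₀) ∈ D := by
    intro k j
    refine rankOne_mem_of_basis (blockLinear K V k j) D w₀ b fun i => ?_
    rw [← hD]
    refine ⟨_, mul_mem_cornerSpan (op (ofBlock (block k j (rankOne v₀ w₀))
      (block_mem _ _ (rankOne_mem _ _)))) i, ?_⟩
    change onSum K V _ = block k j _
    simp [diagonal_mul_block, block_mul_diagonal, rankOne_mul_rankOne, h]
  have hdiagonal : ∀ v, diagonal (rankOne v w₀) ∈ D := by
    refine rankOne_mem_of_basis (diagonalLinear K V) D w₀ b fun i => ?_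
    rw [← hD]
    refine ⟨_, mul_mem_cornerSpan 1 i, ?_⟩
    change onSum K V (ofFiniteRank _ (rankOne_mem _ _) * (baseIdem v₀ w₀ * (1 * baseIdem v₀ w₀))) =
      diagonal _
    rw [one_mul, baseIdem_idem hV h, map_mul, onSum_baseIdem, onSum_ofFiniteRank, ← map_mul,
      rankOne_mul_rankOne, h, one_smul]
  have hmul : ∀ g ∈ blockFiniteRank K V, g * diagonal (rankOne v₀ w₀) ∈ D := by
    intro g hg
    induction hg using AddSubgroup.closure_induction with
    | mem g hg =>
      obtain ⟨i, j, g, -, rfl⟩ := hg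
      rw [block_mul_diagonal, mul_rankOne]
      exact hblock _ _ _
    | zero => rw [zero_mul]; exact zero_mem _
    | add y z _ _ hy hz => rw [add_mul]; exact add_mem hy hz
    | neg y _ hy => rw [neg_mul]; exact neg_mem hy
  have hyD : onSum K V (unop y) ∈ D := by
    have hy : unop y * baseIdem v₀ w₀ = unop y := congrArg unop hy
    have : onSum K V (unop y) = (onSum K V (unop y) - diagonal (onBase K V (unop y))) *
        diagonal (rankOne v₀ w₀) + diagonal (rankOne (onBase K V (unop y) v₀) w₀) := by
      rw [← mul_rankOne, map_mul, sub_mul, sub_add_cancel, ← onSum_baseIdem, ← map_mul, hy]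
    rw [this]
    exact add_mem (hmul _ (onSum_sub_mem _)) (hdiagonal _)
  rw [← hD] at hyD
  obtain ⟨z, hz, hzy⟩ := hyD
  rwa [← unop_injective (onSum_injective hV hzy)]

theorem right_hereditary (I : Ideal (chainRing K V)ᵐᵒᵖ) :
    Module.Projective (chainRing K V)ᵐᵒᵖ I := by
  refine hereditary_of_idempotents (e := op (baseIdem v₀ w₀)) (f := op (blockIdem v₀ w₀))
    (unop_injective (baseIdem_idem hV h))
    (fun a => let ⟨u, hu⟩ := exists_unit_chainRing (unop a);
      ⟨op u, unop_injective (by simpa [mul_assoc] using hu)⟩)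
    (unop_injective (blockIdem_idem hV h)) (unop_injective (blockIdem_mul_baseIdem hV h))
    (unop_injective (baseIdem_mul_blockIdem hV h))
    (by simpa using blockIdem_ne_zero h) ?_ ?_ ?_
    (fun i => op (ofFiniteRank (rankOne (Module.Basis.ofVectorSpace K V i) w₀) (rankOne_mem _ _)))
    ?_ ?_ (fun y => mem_cornerSpan_column hV h _) I
  · intro x
    rcases exists_inv_blockIdem hV h (unop x) with h0 | ⟨y, h1, h2⟩
    · exact .inl (unop_injective (by simpa [mul_assoc] using h0))
    · exact .inr ⟨op y, unop_injective (by simpa [mul_assoc] using h2),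
        unop_injective (by simpa [mul_assoc] using h1)⟩
  · intro g hg h1 h2
    exact (idempotent_below_baseIdem hV h (congrArg unop hg) (congrArg unop h2)
      (congrArg unop h1)).imp unop_mem_sandwich unop_mem_sandwich
  · intro g hg
    exact (idempotent_mem_sandwich hV h (congrArg unop hg)).imp unop_mem_sandwich unop_mem_sandwich
  · intro i
    apply unop_injective
    apply onSum_injective hV
    change onSum K V (ofFiniteRank _ (rankOne_mem _ _) * baseIdem v₀ w₀) =
      onSum K V (ofFiniteRank _ (rankOne_mem _ _))
    rw [map_mul, onSum_baseIdem, onSum_ofFiniteRank, ← map_mul, rankOne_mul_rankOne, h, one_smul]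
  · intro a _ ha h0
    ext1 i
    apply unop_injective
    apply onSum_injective hV
    rw [Finsupp.zero_apply, unop_zero, map_zero]
    exact eq_zero_of_sum_mul_column (Module.Basis.linearIndependent _) ha h0 i

theorem injective_of_annihilator_eq_baseIdeal {U : Type} [AddCommGroup U]
    [Module (chainRing K V)ᵐᵒᵖ U] [IsSimpleModule (chainRing K V)ᵐᵒᵖ U]
    (hU : Module.annihilator (chainRing K V)ᵐᵒᵖ U = baseIdeal K V) :
    Module.Injective (chainRing K V)ᵐᵒᵖ U := by
  obtain ⟨u, hu⟩ : ∃ u : U, op (baseIdem v₀ w₀) • u ≠ 0 := by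
    by_contra! hc
    refine (isPrimitiveLevel_baseIdeal hV h).notMem ?_
    rw [← hU, Module.mem_annihilator]
    exact hc
  have hsmul : ∀ {x y : chainRing K V}, onBase K V x = onBase K V y → op x • u = op y • u := by
    intro x y hxy
    rw [← sub_eq_zero, ← sub_smul]
    refine Module.mem_annihilator.1 (?_ : op x - op y ∈ _) u
    rw [hU, mem_baseIdeal, ← op_sub, unop_op, map_sub, hxy, sub_self]
  let φ : Module.Dual K V →+ U :=
    { toFun w := op (ofFiniteRank (rankOne v₀ w) (rankOne_mem _ _)) • u
      map_zero' := (hsmul (y := 0) (by ext; simp)).trans (by simp)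
      map_add' w w' := by
        rw [← add_smul, ← op_add]
        exact hsmul (by ext; simp [add_smul]) }
  have hφ : ∀ (r : chainRing K V) w, φ (w ∘ₗ onBase K V r) = op r • φ w := by
    intro r w
    change op (ofFiniteRank (rankOne v₀ (w ∘ₗ onBase K V r)) (rankOne_mem _ _)) • u =
      op r • op (ofFiniteRank (rankOne v₀ w) (rankOne_mem _ _)) • u
    rw [smul_smul, ← op_mul]
    exact hsmul (by simp [rankOne_mul])
  have hφ₀ : φ w₀ ≠ 0 := hu
  have hinj : Function.Injective φ := by
    rw [injective_iff_map_eq_zero]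
    intro w hw
    by_contra hw0
    obtain ⟨v, hv⟩ : ∃ v, w v ≠ 0 := by
      by_contra! hc
      exact hw0 (LinearMap.ext hc)
    have := hφ (ofFiniteRank (rankOne ((w v)⁻¹ • v) w₀) (rankOne_mem _ _)) w
    rw [hw, smul_zero] at this
    refine hφ₀ (Eq.trans (congrArg φ ?_) this)
    ext z
    simp [hv]
  have hsurj : Function.Surjective φ := by
    let N : Submodule (chainRing K V)ᵐᵒᵖ U :=
      { φ.range with
        smul_mem' := by
          rintro r _ ⟨w, rfl⟩
          exact ⟨_, hφ (unop r) w⟩ }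
    have hN : N = ⊤ := (eq_bot_or_eq_top N).resolve_left fun hN => hφ₀ (by
      have : φ w₀ ∈ N := ⟨w₀, rfl⟩
      rwa [hN] at this)
    intro z
    have : z ∈ N := hN ▸ Submodule.mem_top
    exact this
  let θ := (AddEquiv.ofBijective φ ⟨hinj, hsurj⟩).symm
  refine injective_of_dual (fun a => let ⟨u, hu⟩ := exists_unit_chainRing a; ⟨u, hu⟩)
    (onBase K V : chainRing K V →+* Module.End K V) θ fun r z v => ?_
  have : θ (op r • z) = θ z ∘ₗ onBase K V r := by
    apply θ.symm.injective
    rw [AddEquiv.symm_apply_apply]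
    change _ = φ _
    rw [hφ]
    change op r • z = op r • θ.symm (θ z)
    rw [AddEquiv.symm_apply_apply]
  rw [this]
  rfl

omit hV h in
theorem injective_of_annihilator_eq_scalarIdeal {U : Type} [AddCommGroup U]
    [Module (chainRing K V)ᵐᵒᵖ U]
    (hU : Module.annihilator (chainRing K V)ᵐᵒᵖ U = scalarIdeal K V) :
    Module.Injective (chainRing K V)ᵐᵒᵖ U := by
  refine injective_of_maximal_level (fun a => ?_) isPrimitiveLevel_scalarIdeal hU.ge
  obtain ⟨u, hu⟩ := exists_unit_chainRing (unop a)
  exact ⟨op u, unop_injective (by simpa [mul_assoc] using hu)⟩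

theorem not_injective_of_annihilator_eq_bot {U : Type} [AddCommGroup U]
    [Module (chainRing K V)ᵐᵒᵖ U] [IsSimpleModule (chainRing K V)ᵐᵒᵖ U]
    (hU : Module.annihilator (chainRing K V)ᵐᵒᵖ U = ⊥) :
    ¬ Module.Injective (chainRing K V)ᵐᵒᵖ U := by
  let f (n : ℕ) : chainRing K V :=
    ofBlock (block n n (rankOne v₀ w₀)) (block_mem _ _ (rankOne_mem _ _))
  have hfin : ∀ x ∈ baseIdeal K V, ∃ m, ∀ n ≥ m, f n * unop x = 0 ∧ unop x * f n = 0 := by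
    intro x hx
    obtain ⟨m, hm⟩ := exists_forall_block_mul_eq_zero (onSum_mem (mem_baseIdeal.1 hx))
    refine ⟨m, fun n hn => ⟨onSum_injective hV ?_, onSum_injective hV ?_⟩⟩
    · rw [map_mul, onSum_ofBlock, (hm n hn n _).1, map_zero]
    · rw [map_mul, onSum_ofBlock, (hm n hn n _).2, map_zero]
  refine not_injective_of_orthogonal (J := baseIdeal K V) (fun n => op (f n)) (fun n => ?_)
    (fun n => unop_injective (onSum_injective hV ?_))
    (fun m n hmn => unop_injective (onSum_injective hV ?_)) (fun x hx => ?_) (fun x hx => ?_)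
    fun n => ?_
  · exact mem_baseIdeal.2 rfl
  · simp [f, block_mul_block, rankOne_idem h]
  · simp [f, block_mul_block_of_ne hmn.symm]
  · obtain ⟨m, hm⟩ := hfin x hx
    refine (Set.finite_lt_nat m).subset fun n hn => ?_
    by_contra hmn
    exact hn (unop_injective (hm n (not_lt.1 hmn)).1)
  · obtain ⟨m, hm⟩ := hfin x hx
    exact ⟨m, unop_injective (hm m le_rfl).2⟩
  · by_contra! hc
    have hn : op (f n) = 0 := by
      rw [← Ideal.mem_bot, ← hU, Module.mem_annihilator]
      exact hc
    have := congrArg (onSum K V) (congrArg unop hn)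
    rw [unop_op, onSum_ofBlock, unop_zero, map_zero, ← block_zero n n] at this
    exact rankOne_ne_zero h (block_injective n n this)

theorem rightSemiartinian : RightSemiartinian (chainRing K V) := fun _ _ _ _ =>
  exists_simple_of_levels (isPrimitiveLevel_bot hV h) (isPrimitiveLevel_baseIdeal hV h)
    isPrimitiveLevel_scalarIdeal (mem_sandwich_of_mem_baseIdeal hV h)
    (mem_sandwich_of_mem_scalarIdeal hV h)

theorem primIdeals_eq : primIdeals (chainRing K V) = {⊥, baseIdeal K V, scalarIdeal K V} := by
  ext P
  constructor
  · rintro ⟨U, _, _, _, rfl⟩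
    have := IsSimpleModule.nontrivial (chainRing K V)ᵐᵒᵖ U
    exact annihilator_mem_of_levels (isPrimitiveLevel_bot hV h) (isPrimitiveLevel_baseIdeal hV h)
      isPrimitiveLevel_scalarIdeal (mem_sandwich_of_mem_baseIdeal hV h)
      (mem_sandwich_of_mem_scalarIdeal hV h)
  · rintro (rfl | rfl | rfl)
    exacts [(isPrimitiveLevel_bot hV h).exists_simple,
      (isPrimitiveLevel_baseIdeal hV h).exists_simple, isPrimitiveLevel_scalarIdeal.exists_simple]

end

end chainRing

/-- there exists a unit-regular, right semiartinian, right and left hereditary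
ring whose right primitive ideals form a three-element chain `P₀ ⊊ P₁ ⊊ P₂`, such that the
simple right modules with annihilator `P₁` or `P₂` are injective while those with annihilator
`P₀` are not. -/
theorem exists_unitRegular_semiartinian_hereditary_chain :
    ∃ (R : Type) (_ : Ring R),
      (∀ a : R, ∃ u : Rˣ, a = a * (u : R) * a) ∧
      RightSemiartinian R ∧
      (∀ I : Ideal Rᵐᵒᵖ, Module.Projective Rᵐᵒᵖ ↥I) ∧
      (∀ I : Ideal R, Module.Projective R ↥I) ∧
      (∃ P₀ P₁ P₂ : Ideal Rᵐᵒᵖ,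
        P₀ < P₁ ∧ P₁ < P₂ ∧ primIdeals R = {P₀, P₁, P₂} ∧
        (∀ (U : Type) (_ : AddCommGroup U) (_ : Module Rᵐᵒᵖ U), IsSimpleModule Rᵐᵒᵖ U →
          ((Module.annihilator Rᵐᵒᵖ U = P₁ ∨ Module.annihilator Rᵐᵒᵖ U = P₂) →
            Module.Injective Rᵐᵒᵖ U) ∧
          (Module.annihilator Rᵐᵒᵖ U = P₀ → ¬ Module.Injective Rᵐᵒᵖ U))) := by
  have hV : ¬ Module.Finite ℚ (Polynomial ℚ) := Polynomial.not_finite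
  obtain ⟨w₀, h⟩ := Module.Projective.exists_dual_eq_one ℚ (one_ne_zero (α := Polynomial ℚ))
  exact ⟨chainRing ℚ (Polynomial ℚ), inferInstance, exists_unit_chainRing,
    chainRing.rightSemiartinian hV h, chainRing.right_hereditary hV h,
    chainRing.left_hereditary hV h, ⊥, chainRing.baseIdeal _ _, chainRing.scalarIdeal _ _,
    chainRing.bot_lt_baseIdeal, chainRing.baseIdeal_lt_scalarIdeal hV,
    chainRing.primIdeals_eq hV h, fun U _ _ _ =>
      ⟨fun hU => hU.elim (chainRing.injective_of_annihilator_eq_baseIdeal hV h)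
        chainRing.injective_of_annihilator_eq_scalarIdeal,
      chainRing.not_injective_of_annihilator_eq_bot hV h⟩⟩
end
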